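/- arXiv:2506.08858 — 2 statements merged into one kernel-verified Lean document; each statement's English description precedes it below -/
import Mathlib

section
/- Let (W, S) be a finite Coxeter system with longest element w₀ and fix a reduced word ω₀ for w₀. Label each covering relation v ⋖ vs of the right weak order on W by the reflection v s v⁻¹, and order the set of reflections by the heap poset heap(ω₀). Then for every non-square polygon P of the weak order, one of the two maximal chains of P has strictly increasing labels with respect to heap(ω₀) and the other has strictly decreasing labels. -/
/-! Generic order-theoretic definitions: covering relations, intervals, maximal
chains in subposets, polygons, polygon/square moves, square-equivalence,
ascending chains with respect to an edge labelling, increasing polygon moves,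
and the induced preorder on (square-equivalence classes of) maximal chains. -/

section GenericOrder

variable {α : Type*}

/-- `b` covers `a` with respect to the relation `r`. -/
def CovR (r : α → α → Prop) (a b : α) : Prop :=
  r a b ∧ a ≠ b ∧ ∀ z, r a z → r z b → z = a ∨ z = b

/-- The closed interval from `x` to `y` with respect to `r`. -/
def IccR (r : α → α → Prop) (x y : α) : Set α := {z | r x z ∧ r z y}

/-- `C` is a maximal chain of the subposet `S` (with respect to `r`). -/
def MaxChainIn (r : α → α → Prop) (S C : Set α) : Prop :=
  C ⊆ S ∧ IsChain r C ∧ ∀ C' : Set α, C' ⊆ S → IsChain r C' → C ⊆ C' → C = C'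

/-- `(x, y, C₁, C₂)` form a polygon: the interval `[x, y]` has exactly the two
distinct maximal chains `C₁ ≠ C₂`, whose union is the interval and whose
intersection is `{x, y}`. -/
def IsPolygonPair (r : α → α → Prop) (x y : α) (C₁ C₂ : Set α) : Prop :=
  r x y ∧ MaxChainIn r (IccR r x y) C₁ ∧ MaxChainIn r (IccR r x y) C₂ ∧
    C₁ ≠ C₂ ∧ IccR r x y = C₁ ∪ C₂ ∧ C₁ ∩ C₂ = {x, y} ∧
    ∀ C : Set α, MaxChainIn r (IccR r x y) C → C = C₁ ∨ C = C₂

/-- `P` is a polygon with respect to `r`. -/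
def IsPolygon (r : α → α → Prop) (P : Set α) : Prop :=
  ∃ x y C₁ C₂, P = IccR r x y ∧ IsPolygonPair r x y C₁ C₂

/-- `C` and `C'` are related by a polygon move. -/
def PolygonMove (r : α → α → Prop) (C C' : Set α) : Prop :=
  ∃ x y P₁ P₂, IsPolygonPair r x y P₁ P₂ ∧ P₁ ⊆ C ∧ P₂ ⊆ C' ∧ C \ P₁ = C' \ P₂

/-- `C` and `C'` are related by a square move: a polygon move across a
four-element polygon. -/
def SquareMove (r : α → α → Prop) (C C' : Set α) : Prop :=
  ∃ x y P₁ P₂, IsPolygonPair r x y P₁ P₂ ∧ (IccR r x y).ncard = 4 ∧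
    P₁ ⊆ C ∧ P₂ ⊆ C' ∧ C \ P₁ = C' \ P₂

/-- Square-equivalence: the reflexive-transitive closure of square moves. -/
def SqEquiv (r : α → α → Prop) : Set α → Set α → Prop :=
  Relation.ReflTransGen (SquareMove r)

/-- The chain `C` has strictly increasing edge labels (with respect to the
strict order `lt` on labels): for any two covering pairs occurring along `C`,
the earlier one has strictly smaller label. -/
def ChainAscending {E : Type*} (r : α → α → Prop) (lab : α → α → E)
    (lt : E → E → Prop) (C : Set α) : Prop :=
  ∀ a b c d, a ∈ C → b ∈ C → c ∈ C → d ∈ C →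
    CovR r a b → CovR r c d → r b c → lt (lab a b) (lab c d)

/-- `C'` is an increasing polygon move of `C`: they differ by a polygon move
across a non-square polygon, with `C` containing the ascending chain. -/
def IncPolygonMove {E : Type*} (r : α → α → Prop) (lab : α → α → E)
    (lt : E → E → Prop) (C C' : Set α) : Prop :=
  ∃ x y P₁ P₂, IsPolygonPair r x y P₁ P₂ ∧ (IccR r x y).ncard ≠ 4 ∧
    P₁ ⊆ C ∧ P₂ ⊆ C' ∧ C \ P₁ = C' \ P₂ ∧ ChainAscending r lab lt P₁

/-- The preorder `≼` on (square-equivalence classes of) maximal chains: the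
smallest preorder generated by square moves and increasing polygon moves. -/
def MGPre {E : Type*} (r : α → α → Prop) (lab : α → α → E) (lt : E → E → Prop) :
    Set α → Set α → Prop :=
  Relation.ReflTransGen (fun A B => SqEquiv r A B ∨ IncPolygonMove r lab lt A B)

/-- `[C'] covers [C]` in the preorder `≼` on square-equivalence classes of
maximal chains: `[C] ≺ [C']` and every class weakly between them equals `[C]`
or `[C']`. -/
def MGCover {E : Type*} (r : α → α → Prop) (lab : α → α → E) (lt : E → E → Prop)
    (C C' : Set α) : Prop :=
  MGPre r lab lt C C' ∧ ¬ MGPre r lab lt C' C ∧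
    ∀ D : Set α, IsMaxChain r D → MGPre r lab lt C D → MGPre r lab lt D C' →
      SqEquiv r D C ∨ SqEquiv r D C'

/-- The labelling is polygon-complete: increasing polygon moves always give
covering relations of the preorder on square-equivalence classes. -/
def PolygonComplete {E : Type*} (r : α → α → Prop) (lab : α → α → E)
    (lt : E → E → Prop) : Prop :=
  ∀ C C' : Set α, IsMaxChain r C → IsMaxChain r C' → IncPolygonMove r lab lt C C' →
    MGCover r lab lt C C'

end GenericOrder

/-! Coxeter-specific definitions: the right weak order, its labelling by
reflections, commutation moves, heap posets of reduced words, and (maximal)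
dihedral reflection subgroups. -/

section CoxeterDefs

variable {B : Type*} {W : Type*} [Group W] {M : CoxeterMatrix B}

/-- The right weak Bruhat order: `u ≤ w` iff `ℓ(u) + ℓ(u⁻¹ w) = ℓ(w)`. -/
def weakLE (cs : CoxeterSystem M W) (u w : W) : Prop :=
  cs.length u + cs.length (u⁻¹ * w) = cs.length w

/-- The set of labels of the covering relations of a chain `C` in the right
weak order: the covering relation `v ⋖ v s` is labelled by the reflection
`v s v⁻¹`, i.e. the cover `u ⋖ w` is labelled by `w * u⁻¹`. -/
def chainLabels (cs : CoxeterSystem M W) (C : Set W) : Set W :=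
  {t | ∃ u w : W, u ∈ C ∧ w ∈ C ∧ CovR (weakLE cs) u w ∧ t = w * u⁻¹}

/-- `ω'` is obtained from `ω` by one commutation move: swapping an adjacent
pair of commuting letters. -/
def CommMove (cs : CoxeterSystem M W) (ω ω' : List B) : Prop :=
  ∃ (l r : List B) (i j : B),
    cs.simple i * cs.simple j = cs.simple j * cs.simple i ∧
    ω = l ++ i :: j :: r ∧ ω' = l ++ j :: i :: r

/-- The strict heap order of a word `ω`: the transitive closure of the
relations `t_j < t_k` for `j < k` in the (left) inversion sequence of `ω`
whenever `t_j` and `t_k` do not commute. -/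
def heapLt (cs : CoxeterSystem M W) (ω : List B) : W → W → Prop :=
  Relation.TransGen (fun a b => ∃ j k : ℕ, j < k ∧
    (cs.leftInvSeq ω)[j]? = some a ∧ (cs.leftInvSeq ω)[k]? = some b ∧
    a * b ≠ b * a)

/-- A dihedral reflection subgroup: a subgroup generated by two reflections. -/
def IsDihedralSubgroup (cs : CoxeterSystem M W) (D : Subgroup W) : Prop :=
  ∃ t₁ t₂ : W, cs.IsReflection t₁ ∧ cs.IsReflection t₂ ∧
    D = Subgroup.closure {t₁, t₂}

/-- A maximal dihedral reflection subgroup: maximal under inclusion among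
dihedral reflection subgroups. -/
def IsMaxDihedralSubgroup (cs : CoxeterSystem M W) (D : Subgroup W) : Prop :=
  IsDihedralSubgroup cs D ∧
    ∀ D' : Subgroup W, IsDihedralSubgroup cs D' → D ≤ D' → D = D'

/-- The set of reflections of `W` contained in a subgroup `D`. -/
def reflectionsIn (cs : CoxeterSystem M W) (D : Subgroup W) : Set W :=
  {t | cs.IsReflection t ∧ t ∈ D}

/-- `D` contains two non-commuting reflections. -/
def IsNonCommutative (cs : CoxeterSystem M W) (D : Subgroup W) : Prop :=
  ∃ t t' : W, cs.IsReflection t ∧ cs.IsReflection t' ∧ t ∈ D ∧ t' ∈ D ∧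
    t * t' ≠ t' * t

/-- `t` occurs strictly before `t'` in the inversion sequence of `ω`. -/
def seqBefore (cs : CoxeterSystem M W) (ω : List B) (t t' : W) : Prop :=
  ∃ j k : ℕ, j < k ∧ (cs.leftInvSeq ω)[j]? = some t ∧
    (cs.leftInvSeq ω)[k]? = some t'

/-- `t` occurs strictly before `t'` in the label sequence of the chain `C`
of the right weak order. -/
def chainBefore (cs : CoxeterSystem M W) (C : Set W) (t t' : W) : Prop :=
  ∃ a b c d : W, a ∈ C ∧ b ∈ C ∧ c ∈ C ∧ d ∈ C ∧
    CovR (weakLE cs) a b ∧ CovR (weakLE cs) c d ∧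
    t = b * a⁻¹ ∧ t' = d * c⁻¹ ∧ weakLE cs b c

/-- The inversion set `inv_ω(C)` of a maximal chain `C`: the set of
non-commutative maximal dihedral reflection subgroups whose reflections occur
in the label sequence of `C` in a different relative order from the inversion
sequence of `ω`. -/
def invSubgroups (cs : CoxeterSystem M W) (ω : List B) (C : Set W) :
    Set (Subgroup W) :=
  {D | IsMaxDihedralSubgroup cs D ∧ IsNonCommutative cs D ∧
    ∃ t t' : W, cs.IsReflection t ∧ cs.IsReflection t' ∧ t ∈ D ∧ t' ∈ D ∧
      seqBefore cs ω t t' ∧ chainBefore cs C t' t}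

end CoxeterDefs

namespace WOL

open CoxeterSystem

section Eta

variable {B W : Type*} [Group W] {M : CoxeterMatrix B} (cs : CoxeterSystem M W)

open Classical in
/-- generator action on pairs -/
noncomputable def gen (i : B) : Function.End (W × ZMod 2) :=
  fun p => (cs.simple i * p.1 * cs.simple i, p.2 + if p.1 = cs.simple i then 1 else 0)

open Classical in
theorem gen_pow (i j : B) (n : ℕ) (t : W) (e : ZMod 2) :
    ((gen cs i * gen cs j) ^ n) (t, e) =
      ((cs.simple i * cs.simple j) ^ n * t * ((cs.simple i * cs.simple j) ^ n)⁻¹,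
        e + ∑ l ∈ Finset.range (2 * n),
          if t = ((cs.simple i * cs.simple j) ^ l)⁻¹ * cs.simple j then (1 : ZMod 2) else 0) := by
  induction n with
  | zero => simp; rfl
  | succ n ih =>
    rw [pow_succ']
    change (gen cs i * gen cs j) (((gen cs i * gen cs j) ^ n) (t, e)) = _
    rw [ih]
    set a := cs.simple i * cs.simple j with ha
    have hai : a⁻¹ = cs.simple j * cs.simple i := by simp [ha]
    have hsj : ∀ k : ℕ, cs.simple j * a ^ k = (a ^ k)⁻¹ * cs.simple j := by
      intro k
      induction k with
      | zero => simp
      | succ k ihk =>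
        rw [pow_succ, ← mul_assoc, ihk]
        have : cs.simple j * a = a⁻¹ * cs.simple j := by rw [hai, ha, mul_assoc]
        rw [mul_assoc, this, ← mul_assoc, ← mul_inv_rev, ← pow_succ', pow_succ]
    have e1 : (a ^ n * t * (a ^ n)⁻¹ = cs.simple j) ↔ t = (a ^ (2 * n))⁻¹ * cs.simple j := by
      have : (a ^ (2 * n))⁻¹ * cs.simple j = (a ^ n)⁻¹ * cs.simple j * a ^ n := by
        rw [mul_assoc, hsj, ← mul_assoc, ← mul_inv_rev, ← pow_add, two_mul]
      rw [this, mul_inv_eq_iff_eq_mul, ← eq_inv_mul_iff_mul_eq, mul_assoc]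
    have e2 : (cs.simple j * (a ^ n * t * (a ^ n)⁻¹) * cs.simple j = cs.simple i) ↔
        t = (a ^ (2 * n + 1))⁻¹ * cs.simple j := by
      have : (a ^ (2 * n + 1))⁻¹ * cs.simple j =
          (a ^ n)⁻¹ * (cs.simple j * cs.simple i * cs.simple j) * a ^ n := by
        have h : a⁻¹ * (a ^ n)⁻¹ = (a ^ n)⁻¹ * a⁻¹ := by
          rw [← mul_inv_rev, ← mul_inv_rev, ← pow_succ, ← pow_succ']
        rw [mul_assoc, mul_assoc, hsj, ← hai, pow_succ', two_mul, pow_add]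
        simp only [mul_inv_rev, mul_assoc]
        rw [← mul_assoc a⁻¹ (a ^ n)⁻¹, h]
        simp only [mul_assoc]
      rw [this]
      constructor
      · intro h
        rw [← h]; simp [mul_assoc]
      · rintro rfl
        simp [mul_assoc]
    change (gen cs i (gen cs j _)) = _
    simp only [gen]
    rw [show 2 * (n + 1) = 2 * n + 1 + 1 by ring, Finset.sum_range_succ, Finset.sum_range_succ]
    refine Prod.ext ?_ ?_
    · rw [pow_succ' a n, mul_inv_rev, hai]; simp [ha, mul_assoc]
    · simp only [e1, e2, add_assoc]

theorem gen_liftable : M.IsLiftable (gen cs) := by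
  classical
  intro i j
  funext ⟨t, e⟩
  rw [gen_pow]
  have h : (cs.simple i * cs.simple j) ^ (M i j) = 1 := cs.simple_mul_simple_pow i j
  have : ∑ l ∈ Finset.range (2 * M i j),
          (if t = ((cs.simple i * cs.simple j) ^ l)⁻¹ * cs.simple j then (1 : ZMod 2) else 0) = 0 := by
    rw [two_mul, Finset.sum_range_add]
    simp only [pow_add, h, one_mul]
    exact CharTwo.add_self_eq_zero _
  rw [this, h]
  simp
  rfl

noncomputable def Phi : W →* Function.End (W × ZMod 2) := cs.lift ⟨gen cs, gen_liftable cs⟩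

noncomputable def eta (w t : W) : ZMod 2 := (Phi cs w⁻¹ (t, 0)).2

theorem Phi_apply (w t : W) (e : ZMod 2) :
    Phi cs w (t, e) = (w * t * w⁻¹, e + eta cs w⁻¹ t) := by
  classical
  induction w using cs.simple_induction_left generalizing t e with
  | one =>
    have : ∀ e, Phi cs (1 : W) (t, e) = (t, e) := by intro e; rw [map_one]; rfl
    simp [eta, this]
  | mul_simple_left w i ih =>
    have h : ∀ e, Phi cs (cs.simple i * w) (t, e) = gen cs i (Phi cs w (t, e)) := by
      intro e
      rw [map_mul]
      change (Phi cs (cs.simple i)) _ = _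
      rw [Phi, lift_apply_simple]
    unfold eta
    rw [inv_inv, h, h, ih, ih]
    simp [gen, mul_assoc, add_assoc]

theorem eta_one (t : W) : eta cs 1 t = 0 := by
  simp [eta]; rfl

open Classical in
theorem eta_simple (i : B) (t : W) : eta cs (cs.simple i) t = if t = cs.simple i then 1 else 0 := by
  simp [eta, Phi, lift_apply_simple, gen]

theorem eta_mul (u v t : W) : eta cs (u * v) t = eta cs u t + eta cs v (u⁻¹ * t * u) := by
  have h : Phi cs (u * v)⁻¹ (t, 0) = Phi cs v⁻¹ (Phi cs u⁻¹ (t, 0)) := by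
    rw [mul_inv_rev, map_mul]; rfl
  rw [Phi_apply, Phi_apply, Phi_apply] at h
  simpa using congrArg Prod.snd h

open Classical in
theorem eta_wordProd (ω : List B) (t : W) :
    eta cs (cs.wordProd ω) t = ((cs.leftInvSeq ω).count t : ZMod 2) := by
  induction ω generalizing t with
  | nil => simp [eta_one]
  | cons i ω ih =>
    rw [wordProd_cons, eta_mul, ih, leftInvSeq, List.count_cons, eta_simple]
    have : t = MulAut.conj (cs.simple i) ((cs.simple i)⁻¹ * t * cs.simple i) := by
      simp [mul_assoc]
    conv_rhs => rw [this, List.count_map_of_injective _ _ (MulAut.conj (cs.simple i)).injective, ← this]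
    push_cast
    rw [add_comm]
    congr 1
    by_cases h : t = cs.simple i
    · subst h; simp
    · simp [h, Ne.symm h]

def NN (w : W) : Set W := {t | eta cs w t = 1}

theorem mem_NN {ω : List B} (h : cs.IsReduced ω) (t : W) :
    t ∈ NN cs (cs.wordProd ω) ↔ t ∈ cs.leftInvSeq ω := by
  classical
  unfold NN
  rw [Set.mem_ofPred_eq, eta_wordProd]
  by_cases ht : t ∈ cs.leftInvSeq ω
  · simp [ht, List.count_eq_one_of_mem h.nodup_leftInvSeq ht]
  · simp [ht, List.count_eq_zero_of_not_mem ht]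

theorem NN_ncard (w : W) : (NN cs w).ncard = cs.length w := by
  classical
  obtain ⟨ω, h, rfl⟩ := cs.exists_isReduced w
  have : NN cs (cs.wordProd ω) = ((cs.leftInvSeq ω).toFinset : Set W) := by
    ext t; simp [mem_NN cs h]
  rw [this, Set.ncard_coe_finset, List.toFinset_card_of_nodup h.nodup_leftInvSeq,
    length_leftInvSeq, h.eq]

theorem isLeftInversion_of_mem {w t : W} (h : t ∈ NN cs w) : cs.IsLeftInversion w t := by
  obtain ⟨ω, hω, rfl⟩ := cs.exists_isReduced w
  exact cs.isLeftInversion_of_mem_leftInvSeq hω ((mem_NN cs hω t).1 h)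

theorem zmod2 (a : ZMod 2) : a = 0 ∨ a = 1 := by
  revert a; decide

theorem eta_zero_iff {w t : W} : eta cs w t = 0 ↔ t ∉ NN cs w := by
  rcases zmod2 (eta cs w t) with h | h <;> simp [NN, h]

theorem eta_inv (w t : W) : eta cs w⁻¹ t = eta cs w (w * t * w⁻¹) := by
  have := eta_mul cs w w⁻¹ (w * t * w⁻¹)
  rw [mul_inv_cancel, eta_one] at this
  simp only [mul_assoc, inv_mul_cancel, inv_mul_cancel_left, mul_one] at this
  have h := CharTwo.add_eq_zero.1 this.symm
  rw [← mul_assoc] at h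
  exact h.symm

theorem eta_self {t : W} (ht : cs.IsReflection t) : eta cs t t = 1 := by
  obtain ⟨u, i, rfl⟩ := ht
  rw [mul_assoc, eta_mul, eta_mul, ← mul_assoc]
  simp only [eta_simple, mul_assoc, inv_mul_cancel, inv_mul_cancel_left, mul_one, simple_mul_simple_cancel_left, inv_simple]
  simp only [if_true, simple_mul_simple_self]
  rw [eta_inv, ← mul_assoc, add_left_comm, CharTwo.add_self_eq_zero, add_zero]

theorem mem_NN_iff {w t : W} : t ∈ NN cs w ↔ cs.IsLeftInversion w t := by
  refine ⟨isLeftInversion_of_mem cs, fun h => ?_⟩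
  by_contra hn
  rw [← eta_zero_iff] at hn
  have h1 : t ∈ NN cs (t * w) := by
    change eta cs _ _ = 1
    rw [eta_mul, eta_self cs h.1]
    simp [hn]
  have h2 := isLeftInversion_of_mem cs h1
  rw [h.1.isLeftInversion_mul_right_iff] at h2
  exact h2 h

theorem NN_finite (w : W) : (NN cs w).Finite := by
  classical
  obtain ⟨ω, h, rfl⟩ := cs.exists_isReduced w
  have : NN cs (cs.wordProd ω) = ((cs.leftInvSeq ω).toFinset : Set W) := by
    ext t; simp [mem_NN cs h]
  rw [this]; exact Finset.finite_toSet _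

theorem mem_NN_mul {u v t : W} : t ∈ NN cs (u * v) ↔ ¬ (t ∈ NN cs u ↔ u⁻¹ * t * u ∈ NN cs v) := by
  simp only [NN, Set.mem_ofPred_eq, eta_mul]
  rcases zmod2 (eta cs u t) with h | h <;>
  rcases zmod2 (eta cs v (u⁻¹ * t * u)) with h' | h' <;> rw [h, h'] <;> decide

theorem weakLE_iff {a b : W} : weakLE cs a b ↔ NN cs a ⊆ NN cs b := by
  have key : (NN cs (a⁻¹ * b)).ncard = (NN cs b \ NN cs a).ncard + (NN cs a \ NN cs b).ncard := by
    have : NN cs (a⁻¹ * b) = (fun t => a⁻¹ * t * a) '' ((NN cs b \ NN cs a) ∪ (NN cs a \ NN cs b)) := by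
      ext t
      have h := mem_NN_mul cs (u := a) (v := a⁻¹ * b) (t := a * t * a⁻¹)
      simp only [mul_assoc, inv_mul_cancel, inv_mul_cancel_left, mul_inv_cancel_left, mul_one] at h
      constructor
      · intro ht
        refine ⟨a * t * a⁻¹, ?_, by simp [mul_assoc]⟩
        simp only [mul_assoc, Set.mem_union, Set.mem_sdiff]
        tauto
      · rintro ⟨q, hq, rfl⟩
        simp only [mul_assoc, mul_inv_cancel_left, mul_inv_cancel, mul_one] at h ⊢
        simp only [Set.mem_union, Set.mem_sdiff] at hq
        tauto
    rw [this, Set.ncard_image_of_injective _ (fun x y h => by simpa using h), Set.ncard_union_eq _ ((NN_finite cs b).subset Set.sdiff_subset) ((NN_finite cs a).subset Set.sdiff_subset)]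
    · exact Set.disjoint_left.2 (fun x h h' => h.2 h'.1)
  unfold weakLE
  rw [← NN_ncard, ← NN_ncard, ← NN_ncard, key]
  have h1 := Set.ncard_inter_add_ncard_sdiff_eq_ncard (NN cs a) (NN cs b) (NN_finite cs a)
  have h2 := Set.ncard_inter_add_ncard_sdiff_eq_ncard (NN cs b) (NN cs a) (NN_finite cs b)
  rw [Set.inter_comm] at h2
  rw [← Set.sdiff_eq_empty, ← Set.ncard_eq_zero ((NN_finite cs a).subset Set.sdiff_subset)]
  omega

theorem NN_inj {a b : W} (h : NN cs a = NN cs b) : a = b := by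
  have h1 : weakLE cs a b := (weakLE_iff cs).2 h.le
  unfold weakLE at h1
  rw [← NN_ncard cs a, ← NN_ncard cs b, h] at h1
  have : cs.length (a⁻¹ * b) = 0 := by omega
  rw [length_eq_zero_iff, inv_mul_eq_one] at this
  exact this

end Eta

end WOL

namespace WOL

open CoxeterSystem

section Dihedral

def rr {W : Type*} [Group W] (s t : W) (k : ℕ) : W := (s * t) ^ k * s

def pp {W : Type*} [Group W] (s t : W) : ℕ → W
  | 0 => 1
  | k + 1 => rr s t k * pp s t k

variable {W : Type*} [Group W] {s t : W}

theorem s_zpow (hs : s * s = 1) (ht : t * t = 1) (n : ℤ) :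
    s * (s * t) ^ n = (s * t) ^ (-n) * s := by
  have h1 : s⁻¹ = s := inv_eq_of_mul_eq_one_left hs
  have h2 : t⁻¹ = t := inv_eq_of_mul_eq_one_left ht
  have h3 : SemiconjBy s (s * t) ((s * t)⁻¹) := by
    simp [SemiconjBy, h1, h2, mul_assoc]
    rw [← mul_assoc, hs, one_mul, mul_one]
  have := h3.zpow_right n
  rw [SemiconjBy, inv_zpow', ] at this
  exact this

theorem s_pow (hs : s * s = 1) (ht : t * t = 1) (n : ℕ) :
    s * (s * t) ^ n = ((s * t) ^ n)⁻¹ * s := by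
  have := s_zpow hs ht n
  simpa using this

theorem pp_two (hs : s * s = 1) (ht : t * t = 1) (n : ℕ) :
    pp s t (2 * n) = (s * t) ^ n ∧ pp s t (2 * n + 1) = (s * t) ^ n * s := by
  induction n with
  | zero => simp [pp, rr]
  | succ n ih =>
    have h1 : pp s t (2 * (n + 1)) = (s * t) ^ (n + 1) := by
      change rr s t (2 * n + 1) * pp s t (2 * n + 1) = _
      rw [ih.2, rr, mul_assoc, ← mul_assoc s, s_pow hs ht, mul_assoc, hs, mul_one,
        mul_inv_eq_iff_eq_mul, ← pow_add]
      congr 1; omega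
    refine ⟨h1, ?_⟩
    change rr s t (2 * (n + 1)) * pp s t (2 * (n + 1)) = _
    rw [h1, rr, mul_assoc, s_pow hs ht, ← mul_assoc]
    congr 1
    rw [mul_inv_eq_iff_eq_mul, ← pow_add]
    congr 1; omega

theorem pp_succ (hs : s * s = 1) (ht : t * t = 1) (k : ℕ) :
    pp s t (k + 1) = pp s t k * s ∨ pp s t (k + 1) = pp s t k * t := by
  rcases Nat.even_or_odd' k with ⟨n, rfl | rfl⟩
  · left; rw [(pp_two hs ht n).1, (pp_two hs ht n).2]
  · right
    rw [(pp_two hs ht n).2]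
    change pp s t (2 * (n + 1)) = _
    rw [(pp_two hs ht (n + 1)).1, pow_succ, mul_assoc]

theorem rr_inj {k l : ℕ} (hk : k < orderOf (s * t)) (hl : l < orderOf (s * t))
    (h : rr s t k = rr s t l) : k = l :=
  pow_injOn_Iio_orderOf hk hl (mul_right_cancel h)

theorem rr_swap (hs : s * s = 1) (ht : t * t = 1) {l : ℕ} (hl : l < orderOf (s * t)) :
    rr t s l = rr s t (orderOf (s * t) - 1 - l) := by
  have h1 : s⁻¹ = s := inv_eq_of_mul_eq_one_left hs
  have h2 : t⁻¹ = t := inv_eq_of_mul_eq_one_left ht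
  have h3 : t * s = (s * t)⁻¹ := by simp [h1, h2]
  rw [rr, rr, h3, inv_pow, inv_mul_eq_iff_eq_mul, ← mul_assoc, ← pow_add]
  have h4 : (s * t) ^ (l + (orderOf (s * t) - 1 - l)) = (s * t)⁻¹ := by
    rw [eq_inv_iff_mul_eq_one, ← pow_succ]
    rw [show l + (orderOf (s * t) - 1 - l) + 1 = orderOf (s * t) by omega, pow_orderOf_eq_one]
  rw [h4, ← h3, mul_assoc, hs, mul_one]

theorem order_swap : orderOf (t * s) = orderOf (s * t) := by
  have h : t * s = MulAut.conj s⁻¹ (s * t) := by simp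
  rw [h]
  exact orderOf_injective (MulAut.conj s⁻¹).toMonoidHom (MulAut.conj s⁻¹).injective _

theorem mem_H (hs : s * s = 1) (ht : t * t = 1) (hm : 0 < orderOf (s * t)) {g : W}
    (hg : g ∈ Subgroup.closure {s, t}) :
    ∃ k ≤ orderOf (s * t), g = pp s t k ∨ g = pp t s k := by
  have h1 : s⁻¹ = s := inv_eq_of_mul_eq_one_left hs
  have h2 : t⁻¹ = t := inv_eq_of_mul_eq_one_left ht
  have h3 : t * s = (s * t)⁻¹ := by simp [h1, h2]
  have h5 : t = s * (s * t) := by rw [← mul_assoc, hs, one_mul]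
  have A : ∃ n : ℤ, g = (s * t) ^ n ∨ g = (s * t) ^ n * s := by
    have step : ∀ x ∈ ({s, t} : Set W), ∀ y : W, (∃ n : ℤ, y = (s * t) ^ n ∨ y = (s * t) ^ n * s) →
        ∃ n : ℤ, x * y = (s * t) ^ n ∨ x * y = (s * t) ^ n * s := by
      rintro x (rfl | rfl) y ⟨n, rfl | rfl⟩
      · exact ⟨-n, Or.inr (s_zpow hs ht n)⟩
      · exact ⟨-n, Or.inl (by rw [← mul_assoc, s_zpow hs ht, mul_assoc, hs, mul_one])⟩
      · refine ⟨-(1 + n), Or.inr ?_⟩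
        rw [← s_zpow hs ht, zpow_add, zpow_one]
        simp only [← mul_assoc]
        rw [hs, one_mul]
      · refine ⟨-(1 + n), Or.inl ?_⟩
        have : (s * x) ^ (-(1 + n)) = (s * x) ^ (-(1 + n)) * s * s := by rw [mul_assoc, hs, mul_one]
        rw [this, ← s_zpow hs ht, zpow_add, zpow_one]
        simp only [← mul_assoc]
        rw [hs, one_mul]
    induction hg using Subgroup.closure_induction_left with
    | one => exact ⟨0, Or.inl (by simp)⟩
    | mul_left x hx y _ ih => exact step x hx y ih
    | inv_mul_cancel x hx y _ ih =>
      have : x⁻¹ = x := by rcases hx with rfl | rfl <;> assumption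
      rw [this]; exact step x hx y ih
  obtain ⟨n, hn⟩ := A
  have : ∃ k < orderOf (s * t), (s * t) ^ n = (s * t) ^ k := by
    refine ⟨(n % (orderOf (s * t) : ℤ)).toNat, ?_, ?_⟩
    · have := Int.emod_lt_of_pos n (b := (orderOf (s * t) : ℤ)) (by exact_mod_cast hm)
      omega
    · rw [← zpow_natCast, Int.toNat_of_nonneg (Int.emod_nonneg _ (by omega)), zpow_mod_orderOf]
  obtain ⟨k, hk, e⟩ := this
  rw [e] at hn
  rcases hn with rfl | rfl
  · by_cases h : 2 * k ≤ orderOf (s * t)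
    · exact ⟨2 * k, h, Or.inl (pp_two hs ht k).1.symm⟩
    · refine ⟨2 * (orderOf (s * t) - k), by omega, Or.inr ?_⟩
      rw [(pp_two ht hs _).1, h3, inv_pow, eq_inv_iff_mul_eq_one, ← pow_add,
        show k + (orderOf (s * t) - k) = orderOf (s * t) by omega, pow_orderOf_eq_one]
  · by_cases h : 2 * k + 1 ≤ orderOf (s * t)
    · exact ⟨2 * k + 1, h, Or.inl (pp_two hs ht k).2.symm⟩
    · refine ⟨2 * (orderOf (s * t) - 1 - k) + 1, by omega, Or.inr ?_⟩
      rw [(pp_two ht hs _).2]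
      change rr s t k = rr t s _
      rw [rr_swap hs ht (by omega)]
      congr 1; omega

theorem rr_mem (k : ℕ) : rr s t k ∈ Subgroup.closure {s, t} := by
  have h1 : s ∈ Subgroup.closure {s, t} := Subgroup.subset_closure (by simp)
  have h2 : t ∈ Subgroup.closure {s, t} := Subgroup.subset_closure (by simp)
  exact mul_mem (pow_mem (mul_mem h1 h2) k) h1

end Dihedral

section Key

variable {B W : Type*} [Group W] {M : CoxeterMatrix B} (cs : CoxeterSystem M W)

theorem NN_one : NN cs 1 = ∅ := by
  ext q; simp [NN, eta_one]

theorem NN_simple (i : B) (q : W) : q ∈ NN cs (cs.simple i) ↔ q = cs.simple i := by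
  classical
  simp only [NN, Set.mem_ofPred_eq, eta_simple]
  split_ifs <;> simp_all

theorem mem_NN_pp (i j : B) {k : ℕ} (hk : k ≤ orderOf (cs.simple i * cs.simple j)) (q : W) :
    q ∈ NN cs (pp (cs.simple i) (cs.simple j) k) ↔
      ∃ l < k, q = rr (cs.simple i) (cs.simple j) l := by
  induction k with
  | zero => simp [pp, NN_one]
  | succ k ih =>
    have ih := ih (by omega)
    have key : ∃ u : B, pp (cs.simple i) (cs.simple j) (k + 1) =
        pp (cs.simple i) (cs.simple j) k * cs.simple u := by
      rcases pp_succ (cs.simple_mul_simple_self i) (cs.simple_mul_simple_self j) k with h | h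
      · exact ⟨i, h⟩
      · exact ⟨j, h⟩
    obtain ⟨u, hu⟩ := key
    have e : (pp (cs.simple i) (cs.simple j) k)⁻¹ * q * pp (cs.simple i) (cs.simple j) k =
        cs.simple u ↔ q = rr (cs.simple i) (cs.simple j) k := by
      have : pp (cs.simple i) (cs.simple j) (k + 1) =
        rr (cs.simple i) (cs.simple j) k * pp (cs.simple i) (cs.simple j) k := rfl
      rw [mul_assoc, inv_mul_eq_iff_eq_mul, ← hu, this, mul_left_inj]
    rw [hu, mem_NN_mul, NN_simple, e, ih]
    constructor
    · intro h
      by_cases hq : q = rr (cs.simple i) (cs.simple j) k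
      · exact ⟨k, by omega, hq⟩
      · simp only [hq, iff_false, not_not] at h
        obtain ⟨l, hl, h⟩ := h
        exact ⟨l, by omega, h⟩
    · rintro ⟨l, hl, rfl⟩ h
      rcases Nat.lt_succ_iff_lt_or_eq.1 hl with h' | rfl
      · have := rr_inj (by omega) (by omega) (h.1 ⟨l, h', rfl⟩)
        omega
      · obtain ⟨l', h1, h2⟩ := h.2 rfl
        have := rr_inj (by omega) (by omega) h2
        omega

theorem K1 [Finite W] (H : Subgroup W) (v : W) :
    ∃ g ∈ H, ∀ q ∈ H, (q ∈ NN cs v ↔ q ∈ NN cs g) := by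
  obtain ⟨h, hmin⟩ := Finite.exists_min (fun h : H => cs.length (h * v))
  refine ⟨(h : W)⁻¹, inv_mem h.2, fun q hq => ?_⟩
  have e : v = (h : W)⁻¹ * (h * v) := by simp
  conv_lhs => rw [e, mem_NN_mul]
  have : ¬ ((h : W)⁻¹⁻¹ * q * (h : W)⁻¹ ∈ NN cs (h * v)) := by
    intro hc
    have h1 := (isLeftInversion_of_mem cs hc).2
    have h2 := hmin ⟨h * q, mul_mem h.2 hq⟩
    simp [mul_assoc] at h1 h2
    omega
  tauto

variable [Finite W] (i j : B) (x : W) (hi : cs.simple i ∉ NN cs x⁻¹) (hj : cs.simple j ∉ NN cs x⁻¹)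

include hi hj

theorem K2 (q : W) (hq : q ∈ Subgroup.closure {cs.simple i, cs.simple j}) : q ∉ NN cs x⁻¹ := by
  obtain ⟨g, hg, H⟩ := K1 cs (Subgroup.closure {cs.simple i, cs.simple j}) x⁻¹
  have hii : cs.simple i ∈ Subgroup.closure {cs.simple i, cs.simple j} :=
    Subgroup.subset_closure (by simp)
  have hjj : cs.simple j ∈ Subgroup.closure {cs.simple i, cs.simple j} :=
    Subgroup.subset_closure (by simp)
  obtain ⟨k, hk, h⟩ := mem_H (cs.simple_mul_simple_self i) (cs.simple_mul_simple_self j)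
    (orderOf_pos _) hg
  rw [H q hq]
  rcases Nat.eq_zero_or_pos k with rfl | hk0
  · rcases h with rfl | rfl <;> simp [pp, NN_one]
  · rcases h with rfl | rfl
    · rw [H _ hii, mem_NN_pp cs i j hk] at hi
      exact absurd ⟨0, hk0, by simp [rr]⟩ hi
    · rw [H _ hjj, mem_NN_pp cs j i (by rwa [order_swap])] at hj
      exact absurd ⟨0, hk0, by simp [rr]⟩ hj

theorem K3 (w q : W) (hq : q ∈ Subgroup.closure {cs.simple i, cs.simple j}) :
    x * q * x⁻¹ ∈ NN cs w ↔ q ∈ NN cs (x⁻¹ * w) := by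
  have := K2 cs i j x hi hj q hq
  rw [mem_NN_mul, inv_inv]
  tauto

theorem KK (w : W) : ∃ k ≤ orderOf (cs.simple i * cs.simple j),
    (∀ l < orderOf (cs.simple i * cs.simple j),
      (x * rr (cs.simple i) (cs.simple j) l * x⁻¹ ∈ NN cs w ↔ l < k)) ∨
    (∀ l < orderOf (cs.simple i * cs.simple j),
      (x * rr (cs.simple i) (cs.simple j) l * x⁻¹ ∈ NN cs w ↔
        orderOf (cs.simple i * cs.simple j) ≤ l + k)) := by
  obtain ⟨g, hg, H⟩ := K1 cs (Subgroup.closure {cs.simple i, cs.simple j}) (x⁻¹ * w)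
  obtain ⟨k, hk, h⟩ := mem_H (cs.simple_mul_simple_self i) (cs.simple_mul_simple_self j)
    (orderOf_pos _) hg
  refine ⟨k, hk, ?_⟩
  rcases h with rfl | rfl
  · left
    intro l hl
    rw [K3 cs i j x hi hj _ _ (rr_mem l), H _ (rr_mem l), mem_NN_pp cs i j hk]
    constructor
    · rintro ⟨l', h1, h2⟩
      have := rr_inj (by omega) (by omega) h2
      omega
    · intro h; exact ⟨l, h, rfl⟩
  · right
    intro l hl
    rw [K3 cs i j x hi hj _ _ (rr_mem l), H _ (rr_mem l),
      mem_NN_pp cs j i (by rwa [order_swap])]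
    constructor
    · rintro ⟨l', h1, h2⟩
      rw [rr_swap (cs.simple_mul_simple_self i) (cs.simple_mul_simple_self j) (by omega)] at h2
      have := rr_inj (by omega) (by omega) h2
      omega
    · intro h
      refine ⟨orderOf (cs.simple i * cs.simple j) - 1 - l, by omega, ?_⟩
      rw [rr_swap (cs.simple_mul_simple_self i) (cs.simple_mul_simple_self j) (by omega)]
      congr 1; omega

theorem rr_not_mem (l : ℕ) : x * rr (cs.simple i) (cs.simple j) l * x⁻¹ ∉ NN cs x := by
  rw [K3 cs i j x hi hj _ _ (rr_mem l)]
  simp [NN_one]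

theorem mem_NN_xpp {k : ℕ} (hk : k ≤ orderOf (cs.simple i * cs.simple j)) (q : W) :
    q ∈ NN cs (x * pp (cs.simple i) (cs.simple j) k) ↔
      q ∈ NN cs x ∨ ∃ l < k, q = x * rr (cs.simple i) (cs.simple j) l * x⁻¹ := by
  have e : ∀ l, x⁻¹ * q * x = rr (cs.simple i) (cs.simple j) l ↔
      q = x * rr (cs.simple i) (cs.simple j) l * x⁻¹ := by
    intro l
    rw [mul_assoc, inv_mul_eq_iff_eq_mul, eq_mul_inv_iff_mul_eq]
  rw [mem_NN_mul, mem_NN_pp cs i j hk]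
  simp only [e]
  have : (∃ l < k, q = x * rr (cs.simple i) (cs.simple j) l * x⁻¹) → q ∉ NN cs x := by
    rintro ⟨l, -, rfl⟩; exact rr_not_mem cs i j x hi hj l
  generalize (∃ l < k, q = x * rr (cs.simple i) (cs.simple j) l * x⁻¹) = P at this ⊢
  clear e
  tauto

/-- comparison along a side of the polygon -/
theorem pp_le_iff {k l : ℕ} (hk : k ≤ orderOf (cs.simple i * cs.simple j))
    (hl : l ≤ orderOf (cs.simple i * cs.simple j)) :
    weakLE cs (x * pp (cs.simple i) (cs.simple j) k) (x * pp (cs.simple i) (cs.simple j) l) ↔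
      k ≤ l := by
  rw [weakLE_iff]
  constructor
  · intro h
    by_contra hc
    have h1 := h ((mem_NN_xpp cs i j x hi hj hk (x * rr (cs.simple i) (cs.simple j) l * x⁻¹)).2
      (Or.inr ⟨l, by omega, rfl⟩))
    rw [mem_NN_xpp cs i j x hi hj hl] at h1
    rcases h1 with h1 | ⟨l', h2, h3⟩
    · exact rr_not_mem cs i j x hi hj _ h1
    · have := rr_inj (by omega) (by omega) (mul_left_cancel (mul_right_cancel h3))
      omega
  · intro h q
    rw [mem_NN_xpp cs i j x hi hj hl, mem_NN_xpp cs i j x hi hj hk]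
    rintro (h1 | ⟨l', h2, h3⟩)
    · exact Or.inl h1
    · exact Or.inr ⟨l', by omega, h3⟩

end Key

end WOL

namespace WOL

open CoxeterSystem

section Main

variable {B W : Type*} [Group W] {M : CoxeterMatrix B} (cs : CoxeterSystem M W)

theorem le_rfl' (a : W) : weakLE cs a a := (weakLE_iff cs).2 subset_rfl

theorem le_trans' {a b c : W} (h : weakLE cs a b) (h' : weakLE cs b c) : weakLE cs a c :=
  (weakLE_iff cs).2 (((weakLE_iff cs).1 h).trans ((weakLE_iff cs).1 h'))

theorem le_antisymm' {a b : W} (h : weakLE cs a b) (h' : weakLE cs b a) : a = b :=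
  NN_inj cs (((weakLE_iff cs).1 h).antisymm ((weakLE_iff cs).1 h'))

theorem exists_step {x a : W} (h : weakLE cs x a) (hne : x ≠ a) :
    ∃ i, cs.simple i ∉ NN cs x⁻¹ ∧ weakLE cs (x * cs.simple i) a := by
  have h1 : x⁻¹ * a ≠ 1 := by rwa [Ne, inv_mul_eq_one]
  obtain ⟨i, hi⟩ := cs.exists_leftDescent_of_ne_one h1
  rw [weakLE_iff] at h
  have h2 : cs.simple i ∈ NN cs (x⁻¹ * a) := by
    rw [mem_NN_iff, isLeftInversion_simple_iff_isLeftDescent]; exact hi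
  have h3 := mem_NN_mul cs (u := x) (v := x⁻¹ * a) (t := x * cs.simple i * x⁻¹)
  have e : x⁻¹ * (x * cs.simple i * x⁻¹) * x = cs.simple i := by simp [mul_assoc]
  rw [e, mul_inv_cancel_left] at h3
  have h4 : x * cs.simple i * x⁻¹ ∉ NN cs x := by
    intro hc
    have := h hc
    tauto
  refine ⟨i, ?_, ?_⟩
  · intro hc
    apply h4
    unfold NN at hc ⊢
    rw [Set.mem_ofPred_eq, eta_inv] at hc
    exact hc
  · rw [weakLE_iff]
    intro q hq
    rw [mem_NN_mul, NN_simple, mul_assoc, inv_mul_eq_iff_eq_mul, ← eq_mul_inv_iff_mul_eq] at hq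
    by_cases hqx : q ∈ NN cs x
    · exact h hqx
    · have : q = x * cs.simple i * x⁻¹ := by tauto
      subst this
      tauto

theorem exists_max [Finite W] (r : W → W → Prop) (S C : Set W) (hC : C ⊆ S) (hc : IsChain r C) :
    ∃ D, C ⊆ D ∧ MaxChainIn r S D := by
  obtain ⟨D, hCD, hD⟩ := (Set.toFinite {D : Set W | D ⊆ S ∧ IsChain r D}).exists_le_maximal
    (a := C) ⟨hC, hc⟩
  refine ⟨D, hCD, hD.1.1, hD.1.2, fun C' h1 h2 h3 => ?_⟩
  exact h3.antisymm (hD.2 ⟨h1, h2⟩ h3)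

/-- One side of the polygon. -/
def side (s t x : W) : Set W := {z | ∃ k ≤ orderOf (s * t), z = x * pp s t k}

variable [Finite W] (i j : B) (x : W) (hi : cs.simple i ∉ NN cs x⁻¹) (hj : cs.simple j ∉ NN cs x⁻¹)

include hi hj

theorem side_asc (R : W → W → Prop)
    (hR : ∀ l l', l < l' → l' < orderOf (cs.simple i * cs.simple j) →
      R (x * rr (cs.simple i) (cs.simple j) l * x⁻¹) (x * rr (cs.simple i) (cs.simple j) l' * x⁻¹)) :
    ChainAscending (weakLE cs) (fun u w => w * u⁻¹) R
      (side (cs.simple i) (cs.simple j) x) := by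
  have cov : ∀ k ≤ orderOf (cs.simple i * cs.simple j),
      ∀ l ≤ orderOf (cs.simple i * cs.simple j),
      CovR (weakLE cs) (x * pp (cs.simple i) (cs.simple j) k)
        (x * pp (cs.simple i) (cs.simple j) l) → l = k + 1 := by
    rintro k hk l hl ⟨h1, h2, h3⟩
    rw [pp_le_iff cs i j x hi hj hk hl] at h1
    have hkl : k < l := by
      rcases h1.lt_or_eq with h | rfl
      · exact h
      · exact absurd rfl h2
    rcases h3 (x * pp (cs.simple i) (cs.simple j) (k + 1))
      ((pp_le_iff cs i j x hi hj hk (by omega)).2 (by omega))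
      ((pp_le_iff cs i j x hi hj (by omega) hl).2 (by omega)) with h | h
    · have := (pp_le_iff cs i j x hi hj (k := k + 1) (by omega) hk).1 (by rw [h]; exact le_rfl' cs _)
      omega
    · have := (pp_le_iff cs i j x hi hj (l := k + 1) hl (by omega)).1 (by rw [h]; exact le_rfl' cs _)
      omega
  have lab : ∀ k, x * pp (cs.simple i) (cs.simple j) (k + 1) *
      (x * pp (cs.simple i) (cs.simple j) k)⁻¹ = x * rr (cs.simple i) (cs.simple j) k * x⁻¹ := by
    intro k
    change x * (rr _ _ k * pp _ _ k) * _ = _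
    simp [mul_assoc]
  rintro _ _ _ _ ⟨a, ha, rfl⟩ ⟨b, hb, rfl⟩ ⟨c, hc, rfl⟩ ⟨d, hd, rfl⟩ hab hcd hbc
  obtain rfl := cov a ha b hb hab
  obtain rfl := cov c hc d hd hcd
  rw [pp_le_iff cs i j x hi hj hb hc] at hbc
  simp only [lab]
  exact hR _ _ (by omega) (by omega)

theorem side_le {y : W} (hx : weakLE cs x y) (h1 : weakLE cs (x * cs.simple i) y)
    (h2 : weakLE cs (x * cs.simple j) y) {k : ℕ}
    (hk : k ≤ orderOf (cs.simple i * cs.simple j)) :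
    weakLE cs (x * pp (cs.simple i) (cs.simple j) k) y := by
  have hm := orderOf_pos (cs.simple i * cs.simple j)
  have h0 : ∀ u, cs.simple u ∉ NN cs x⁻¹ → weakLE cs (x * cs.simple u) y →
      x * cs.simple u * x⁻¹ ∈ NN cs y := by
    intro u hu h
    rw [weakLE_iff] at h
    apply h
    have : x * cs.simple u * x⁻¹ ∉ NN cs x := by
      intro hc; apply hu
      unfold NN at hc ⊢
      rw [Set.mem_ofPred_eq, eta_inv]; exact hc
    have e : x⁻¹ * (x * cs.simple u * x⁻¹) * x = cs.simple u := by simp [mul_assoc]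
    rw [mem_NN_mul, NN_simple, e]
    tauto
  have hi' := h0 i hi h1
  have hj' := h0 j hj h2
  have e1 : cs.simple i = rr (cs.simple i) (cs.simple j) 0 := by simp [rr]
  have e2 : cs.simple j = rr (cs.simple i) (cs.simple j)
      (orderOf (cs.simple i * cs.simple j) - 1) := by
    have := rr_swap (cs.simple_mul_simple_self i) (cs.simple_mul_simple_self j) hm
    simpa [rr] using this
  rw [e1] at hi'
  rw [e2] at hj'
  obtain ⟨k', hk', h⟩ := KK cs i j x hi hj y
  have all : ∀ l < orderOf (cs.simple i * cs.simple j),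
      x * rr (cs.simple i) (cs.simple j) l * x⁻¹ ∈ NN cs y := by
    intro l hl
    rcases h with h | h
    · rw [h _ (by omega)] at hj' ⊢
      omega
    · rw [h _ (by omega)] at hi' ⊢
      omega
  rw [weakLE_iff] at hx ⊢
  intro q hq
  rw [mem_NN_xpp cs i j x hi hj hk] at hq
  rcases hq with hq | ⟨l, hl, rfl⟩
  · exact hx hq
  · exact all l (by omega)

omit hi hj in
theorem pp_top : pp (cs.simple i) (cs.simple j) (orderOf (cs.simple i * cs.simple j)) =
    pp (cs.simple j) (cs.simple i) (orderOf (cs.simple i * cs.simple j)) := by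
  apply NN_inj cs
  have hs := cs.simple_mul_simple_self i
  have ht := cs.simple_mul_simple_self j
  ext q
  rw [mem_NN_pp cs i j le_rfl, mem_NN_pp cs j i (by rw [order_swap])]
  constructor
  · rintro ⟨l, hl, rfl⟩
    refine ⟨orderOf (cs.simple i * cs.simple j) - 1 - l, by omega, ?_⟩
    rw [rr_swap hs ht (by omega)]
    congr 1; omega
  · rintro ⟨l, hl, rfl⟩
    refine ⟨orderOf (cs.simple i * cs.simple j) - 1 - l, by omega, ?_⟩
    rw [rr_swap hs ht (by omega)]

theorem mem_sides {z : W} (h1 : weakLE cs x z)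
    (h2 : weakLE cs z (x * pp (cs.simple i) (cs.simple j) (orderOf (cs.simple i * cs.simple j)))) :
    z ∈ side (cs.simple i) (cs.simple j) x ∨ z ∈ side (cs.simple j) (cs.simple i) x := by
  have hs := cs.simple_mul_simple_self i
  have ht := cs.simple_mul_simple_self j
  rw [weakLE_iff] at h1 h2
  obtain ⟨k, hk, h⟩ := KK cs i j x hi hj z
  rcases h with h | h
  · left
    refine ⟨k, hk, NN_inj cs ?_⟩
    ext q
    rw [mem_NN_xpp cs i j x hi hj hk]
    constructor
    · intro hq
      rcases (mem_NN_xpp cs i j x hi hj le_rfl q).1 (h2 hq) with h3 | ⟨l, hl, rfl⟩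
      · exact Or.inl h3
      · exact Or.inr ⟨l, (h l hl).1 hq, rfl⟩
    · rintro (hq | ⟨l, hl, rfl⟩)
      · exact h1 hq
      · exact (h l (by omega)).2 hl
  · right
    refine ⟨k, by rwa [order_swap], NN_inj cs ?_⟩
    ext q
    rw [mem_NN_xpp cs j i x hj hi (by rwa [order_swap])]
    constructor
    · intro hq
      rcases (mem_NN_xpp cs i j x hi hj le_rfl q).1 (h2 hq) with h3 | ⟨l, hl, rfl⟩
      · exact Or.inl h3
      · have := (h l hl).1 hq
        refine Or.inr ⟨orderOf (cs.simple i * cs.simple j) - 1 - l, by omega, ?_⟩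
        rw [rr_swap hs ht (by omega)]
        congr 3; omega
    · rintro (hq | ⟨l, hl, rfl⟩)
      · exact h1 hq
      · rw [rr_swap hs ht (by omega)]
        exact (h _ (by omega)).2 (by omega)

theorem side_ncard : (side (cs.simple i) (cs.simple j) x).ncard =
    orderOf (cs.simple i * cs.simple j) + 1 := by
  have : side (cs.simple i) (cs.simple j) x =
      (fun k => x * pp (cs.simple i) (cs.simple j) k) ''
        (Finset.range (orderOf (cs.simple i * cs.simple j) + 1) : Set ℕ) := by
    ext z
    simp [side, Nat.lt_succ_iff, eq_comm]
  rw [this, Set.InjOn.ncard_image, Set.ncard_coe_finset, Finset.card_range]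
  intro k hk l hl h
  simp only [Finset.coe_range, Set.mem_Iio] at hk hl h
  apply le_antisymm
  · exact (pp_le_iff cs i j x hi hj (by omega) (by omega)).1 (h ▸ le_rfl' cs _)
  · exact (pp_le_iff cs i j x hi hj (by omega) (by omega)).1 (h ▸ le_rfl' cs _)

theorem side_chain : IsChain (weakLE cs) (side (cs.simple i) (cs.simple j) x) := by
  rintro _ ⟨a, ha, rfl⟩ _ ⟨b, hb, rfl⟩ -
  rcases le_total a b with h | h
  · exact Or.inl ((pp_le_iff cs i j x hi hj ha hb).2 h)
  · exact Or.inr ((pp_le_iff cs i j x hi hj hb ha).2 h)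

/-- positions of the labels in the inversion sequence -/
theorem positions (w₀ : W) (hw₀ : ∀ w : W, cs.length w ≤ cs.length w₀)
    (ω₀ : List B) (hω₀ : cs.IsReduced ω₀) (hω₀p : cs.wordProd ω₀ = w₀)
    (hm : 2 < orderOf (cs.simple i * cs.simple j)) :
    (∀ l l', l < l' → l' < orderOf (cs.simple i * cs.simple j) →
      heapLt cs ω₀ (x * rr (cs.simple i) (cs.simple j) l * x⁻¹)
        (x * rr (cs.simple i) (cs.simple j) l' * x⁻¹)) ∨
    (∀ l l', l < l' → l' < orderOf (cs.simple i * cs.simple j) →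
      heapLt cs ω₀ (x * rr (cs.simple i) (cs.simple j) l' * x⁻¹)
        (x * rr (cs.simple i) (cs.simple j) l * x⁻¹)) := by
  have hs := cs.simple_mul_simple_self i
  have ht := cs.simple_mul_simple_self j
  have hrefl : ∀ l < orderOf (cs.simple i * cs.simple j),
      cs.IsReflection (x * rr (cs.simple i) (cs.simple j) l * x⁻¹) := by
    intro l hl
    apply IsReflection.conj
    exact (isLeftInversion_of_mem cs ((mem_NN_pp cs i j (k := l + 1) (by omega) _).2
      ⟨l, by omega, rfl⟩)).1
  have hpos : ∀ l, ∃ p : ℕ, l < orderOf (cs.simple i * cs.simple j) →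
      (cs.leftInvSeq ω₀)[p]? = some (x * rr (cs.simple i) (cs.simple j) l * x⁻¹) := by
    intro l
    by_cases hl : l < orderOf (cs.simple i * cs.simple j)
    · have : x * rr (cs.simple i) (cs.simple j) l * x⁻¹ ∈ NN cs w₀ := by
        rw [mem_NN_iff]
        refine ⟨hrefl l hl, lt_of_le_of_ne (hw₀ _) ((hrefl l hl).length_mul_right_ne w₀)⟩
      rw [← hω₀p, mem_NN cs hω₀, List.mem_iff_getElem?] at this
      obtain ⟨p, hp⟩ := this
      exact ⟨p, fun _ => hp⟩
    · exact ⟨0, fun h => absurd h hl⟩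
  choose pos hpos using hpos
  -- membership in prefixes
  have hpre : ∀ n, ∀ l < orderOf (cs.simple i * cs.simple j),
      (x * rr (cs.simple i) (cs.simple j) l * x⁻¹ ∈ NN cs (cs.wordProd (ω₀.take n)) ↔ pos l < n) := by
    intro n l hl
    rw [mem_NN cs (hω₀.take n), leftInvSeq_take]
    have hp := hpos l hl
    constructor
    · intro h
      obtain ⟨p, hp'⟩ := List.mem_iff_getElem?.1 h
      rw [List.getElem?_take] at hp'
      split_ifs at hp' with hpn
      have hlt : p < (cs.leftInvSeq ω₀).length := (List.getElem?_eq_some_iff.1 hp').1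
      have := (List.nodup_iff_injective_get.1 hω₀.nodup_leftInvSeq)
      have e : p = pos l := by
        obtain ⟨a1, a2⟩ := List.getElem?_eq_some_iff.1 hp'
        obtain ⟨b1, b2⟩ := List.getElem?_eq_some_iff.1 hp
        have := @this ⟨p, a1⟩ ⟨pos l, b1⟩ (by simp [a2, b2])
        simpa using this
      omega
    · intro h
      rw [List.mem_iff_getElem?]
      exact ⟨pos l, by rw [List.getElem?_take, if_pos h, hp]⟩
  have hinj : ∀ l < orderOf (cs.simple i * cs.simple j),
      ∀ l' < orderOf (cs.simple i * cs.simple j), pos l = pos l' → l = l' := by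
    intro l hl l' hl' h
    have h1 := hpos l hl
    rw [h, hpos l' hl'] at h1
    exact (rr_inj hl' hl (mul_left_cancel (mul_right_cancel (Option.some.inj h1)))).symm
  have hK : ∀ n, ∃ k ≤ orderOf (cs.simple i * cs.simple j),
      (∀ l < orderOf (cs.simple i * cs.simple j), (pos l < n ↔ l < k)) ∨
      (∀ l < orderOf (cs.simple i * cs.simple j), (pos l < n ↔
        orderOf (cs.simple i * cs.simple j) ≤ l + k)) := by
    intro n
    obtain ⟨k, hk, h⟩ := KK cs i j x hi hj (cs.wordProd (ω₀.take n))
    refine ⟨k, hk, ?_⟩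
    rcases h with h | h
    · left; intro l hl; rw [← h l hl, hpre n l hl]
    · right; intro l hl; rw [← h l hl, hpre n l hl]
  have hnc : ∀ l, x * rr (cs.simple i) (cs.simple j) l * x⁻¹ *
      (x * rr (cs.simple i) (cs.simple j) (l + 1) * x⁻¹) ≠
      x * rr (cs.simple i) (cs.simple j) (l + 1) * x⁻¹ *
      (x * rr (cs.simple i) (cs.simple j) l * x⁻¹) := by
    intro l h
    have h1 : rr (cs.simple i) (cs.simple j) l * rr (cs.simple i) (cs.simple j) (l + 1) =
        rr (cs.simple i) (cs.simple j) (l + 1) * rr (cs.simple i) (cs.simple j) l := by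
      simp only [mul_assoc, inv_mul_cancel_left, mul_right_inj] at h
      simpa only [← mul_assoc, mul_left_inj] using h
    have h2 : ∀ a b, rr (cs.simple i) (cs.simple j) a * rr (cs.simple i) (cs.simple j) b =
        (cs.simple i * cs.simple j) ^ a * ((cs.simple i * cs.simple j) ^ b)⁻¹ := by
      intro a b
      rw [rr, rr, ← mul_assoc, mul_assoc _ (cs.simple i), s_pow hs ht, mul_assoc, mul_assoc, hs,
        mul_one]
    rw [h2, h2] at h1
    generalize cs.simple i * cs.simple j = a at h1 hm
    have h3 : a ^ 2 = 1 := by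
      rw [pow_succ' a l] at h1
      have h4 : a ^ l * (a * a ^ l)⁻¹ = a⁻¹ := by simp
      rw [h4] at h1
      simp only [mul_inv_cancel_right] at h1
      rw [pow_two]
      nth_rw 1 [← h1]; simp
    have := orderOf_le_of_pow_eq_one (by norm_num) h3
    omega
  have h0m : pos 0 ≠ pos (orderOf (cs.simple i * cs.simple j) - 1) := by
    intro h
    have := hinj _ (by omega) _ (by omega) h
    omega
  generalize hmm : orderOf (cs.simple i * cs.simple j) = m at *
  rcases lt_or_gt_of_ne h0m with h0 | h0
  · left
    have mono : ∀ l, l + 1 < m → pos l < pos (l + 1) := by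
      intro l hl
      have hne : pos l ≠ pos (l + 1) := fun h => by
        have := hinj _ (by omega) _ (by omega) h
        omega
      obtain ⟨k, hk, h | h⟩ := hK (pos (l + 1) + 1)
      · have a1 := h (l + 1) (by omega)
        have a2 := h l (by omega)
        omega
      · have a1 := h (l + 1) (by omega)
        have a2 := h l (by omega)
        have a3 := h 0 (by omega)
        have a4 := h (m - 1) (by omega)
        omega
    intro l l' hll
    induction l', hll using Nat.le_induction with
    | base =>
      intro hl'
      exact Relation.TransGen.single ⟨pos l, pos (l + 1), mono l hl', hpos _ (by omega),
        hpos _ hl', hnc l⟩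
    | succ n hn ih =>
      intro hl'
      refine (ih (by omega)).tail ⟨pos n, pos (n + 1), mono n hl', hpos _ (by omega),
        hpos _ hl', hnc n⟩
  · right
    have mono : ∀ l, l + 1 < m → pos (l + 1) < pos l := by
      intro l hl
      have hne : pos l ≠ pos (l + 1) := fun h => by
        have := hinj _ (by omega) _ (by omega) h
        omega
      obtain ⟨k, hk, h | h⟩ := hK (pos l + 1)
      · have a1 := h (l + 1) (by omega)
        have a2 := h l (by omega)
        have a3 := h 0 (by omega)
        have a4 := h (m - 1) (by omega)
        omega
      · have a1 := h (l + 1) (by omega)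
        have a2 := h l (by omega)
        omega
    intro l l' hll
    induction l', hll using Nat.le_induction with
    | base =>
      intro hl'
      exact Relation.TransGen.single ⟨pos (l + 1), pos l, mono l hl', hpos _ hl',
        hpos _ (by omega), (hnc l).symm⟩
    | succ n hn ih =>
      intro hl'
      refine Relation.TransGen.head ⟨pos (n + 1), pos n, mono n hl', hpos _ hl',
        hpos _ (by omega), (hnc n).symm⟩ (ih (by omega))

end Main

section Poly

variable {B W : Type*} [Group W] {M : CoxeterMatrix B} (cs : CoxeterSystem M W) [Finite W]

/-- first step of a chain of the polygon -/
theorem first_step {x y : W} {C₁ C₂ : Set W} (hP : IsPolygonPair (weakLE cs) x y C₁ C₂) :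
    ∃ i, cs.simple i ∉ NN cs x⁻¹ ∧ x * cs.simple i ∈ C₁ ∧ x * cs.simple i ∉ C₂ := by
  obtain ⟨hxy, hC₁, hC₂, hne, hun, hint, hall⟩ := hP
  have hx1 : ({x, y} : Set W) ⊆ C₁ := hint ▸ Set.inter_subset_left
  have hx2 : ({x, y} : Set W) ⊆ C₂ := hint ▸ Set.inter_subset_right
  have ha : ∃ a ∈ C₁, a ∉ ({x, y} : Set W) := by
    by_contra hc
    push Not at hc
    exact hne (hC₁.2.2 C₂ hC₂.1 hC₂.2.1 (fun a h => hx2 (hc a h)))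
  obtain ⟨a, ha1, ha2⟩ := ha
  have haI := hC₁.1 ha1
  simp only [Set.mem_insert_iff, Set.mem_singleton_iff, not_or] at ha2
  obtain ⟨i, hi, hia⟩ := exists_step cs haI.1 (Ne.symm ha2.1)
  have hxi : weakLE cs x (x * cs.simple i) := by
    rw [weakLE_iff]
    intro q hq
    rw [mem_NN_mul, NN_simple, mul_assoc, inv_mul_eq_iff_eq_mul, ← eq_mul_inv_iff_mul_eq]
    have : q ≠ x * cs.simple i * x⁻¹ := by
      rintro rfl
      apply hi
      unfold NN at hq ⊢
      rw [Set.mem_ofPred_eq, eta_inv]; exact hq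
    tauto
  have hC : IsChain (weakLE cs) {x * cs.simple i, a} := by
    apply IsChain.insert
    · exact IsChain.singleton
    · rintro b hb -
      rw [Set.mem_singleton_iff.1 hb]; exact Or.inl hia
  obtain ⟨D, hD, hDm⟩ := exists_max (weakLE cs) (IccR (weakLE cs) x y) _ (by
    rintro b (rfl | hb)
    · exact ⟨hxi, le_trans' cs hia haI.2⟩
    · rw [Set.mem_singleton_iff.1 hb]; exact haI) hC
  have haD : a ∈ D := hD (by simp)
  have hDi : x * cs.simple i ∈ D := hD (by simp)
  have ha2' : a ∉ C₂ := by
    intro h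
    have : a ∈ C₁ ∩ C₂ := ⟨ha1, h⟩
    rw [hint] at this
    simp [ha2.1, ha2.2] at this
  have hDC : D = C₁ := by
    rcases hall D hDm with h | h
    · exact h
    · exact absurd (h ▸ haD) ha2'
  refine ⟨i, hi, hDC ▸ hDi, fun hc => ?_⟩
  have : x * cs.simple i ∈ C₁ ∩ C₂ := ⟨hDC ▸ hDi, hc⟩
  rw [hint] at this
  rcases this with h | h
  · have h' : cs.length (cs.simple i) = 0 := by
      rw [mul_eq_left.1 h, length_one]
    simp at h'
  · rw [Set.mem_singleton_iff.1 h] at hia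
    exact ha2.2 (le_antisymm' cs haI.2 hia)

theorem pair_symm {x y : W} {C₁ C₂ : Set W} (hP : IsPolygonPair (weakLE cs) x y C₁ C₂) :
    IsPolygonPair (weakLE cs) x y C₂ C₁ := by
  obtain ⟨hxy, hC₁, hC₂, hne, hun, hint, hall⟩ := hP
  exact ⟨hxy, hC₂, hC₁, hne.symm, by rw [hun, Set.union_comm], by rw [Set.inter_comm, hint],
    fun C h => (hall C h).symm⟩

theorem side_sub {x y : W} {C₁ C₂ : Set W} (hP : IsPolygonPair (weakLE cs) x y C₁ C₂)
    (i j : B) (hi : cs.simple i ∉ NN cs x⁻¹) (hj : cs.simple j ∉ NN cs x⁻¹)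
    (h1 : x * cs.simple i ∈ C₁) (h2 : x * cs.simple i ∉ C₂) (h3 : x * cs.simple j ∈ C₂) :
    side (cs.simple i) (cs.simple j) x ⊆ C₁ := by
  obtain ⟨hxy, hC₁, hC₂, hne, hun, hint, hall⟩ := hP
  have hm := orderOf_pos (cs.simple i * cs.simple j)
  obtain ⟨D, hD, hDm⟩ := exists_max (weakLE cs) (IccR (weakLE cs) x y)
    (side (cs.simple i) (cs.simple j) x) (by
      rintro _ ⟨k, hk, rfl⟩
      refine ⟨?_, side_le cs i j x hi hj hxy (hC₁.1 h1).2 (hC₂.1 h3).2 hk⟩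
      have := (pp_le_iff cs i j x hi hj (Nat.zero_le _) hk).2 (Nat.zero_le k)
      simpa [pp] using this) (side_chain cs i j x hi hj)
  have hin : x * cs.simple i ∈ D := hD ⟨1, hm, by simp [pp, rr]⟩
  rcases hall D hDm with rfl | rfl
  · exact hD
  · exact absurd hin h2

theorem side_eq {x y : W} {C₁ C₂ : Set W} (hP : IsPolygonPair (weakLE cs) x y C₁ C₂)
    (i j : B) (hi : cs.simple i ∉ NN cs x⁻¹) (hj : cs.simple j ∉ NN cs x⁻¹)
    (h1 : x * cs.simple i ∈ C₁) (h2 : x * cs.simple i ∉ C₂) (h3 : x * cs.simple j ∈ C₂)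
    (h4 : x * cs.simple j ∉ C₁) :
    C₁ = side (cs.simple i) (cs.simple j) x := by
  have s1 := side_sub cs hP i j hi hj h1 h2 h3
  have s2 := side_sub cs (pair_symm cs hP) j i hj hi h3 h4 h1
  obtain ⟨hxy, hC₁, hC₂, hne, hun, hint, hall⟩ := hP
  have hm := orderOf_pos (cs.simple i * cs.simple j)
  have htop : x * pp (cs.simple i) (cs.simple j) (orderOf (cs.simple i * cs.simple j)) ∈
      C₁ ∩ C₂ := by
    refine ⟨s1 ⟨_, le_rfl, rfl⟩, ?_⟩
    rw [pp_top]
    exact s2 ⟨_, by rw [order_swap], rfl⟩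
  rw [hint] at htop
  have hy : x * pp (cs.simple i) (cs.simple j) (orderOf (cs.simple i * cs.simple j)) = y := by
    rcases htop with h | h
    · have h' := (pp_le_iff cs i j x hi hj le_rfl (Nat.zero_le _)).1 (by
        rw [h]; simpa [pp] using le_rfl' cs x)
      omega
    · exact h
  refine Set.Subset.antisymm (fun z hz => ?_) s1
  have hzI := hC₁.1 hz
  rcases mem_sides cs i j x hi hj hzI.1 (by rw [hy]; exact hzI.2) with h | h
  · exact h
  · have : z ∈ C₁ ∩ C₂ := ⟨hz, s2 h⟩
    rw [hint] at this
    rcases this with rfl | h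
    · exact ⟨0, Nat.zero_le _, by simp [pp]⟩
    · rw [Set.mem_singleton_iff.1 h, ← hy]
      exact ⟨_, le_rfl, rfl⟩

end Poly

end WOL


/-- Let `(W, S)` be a finite Coxeter system, `w₀` its longest element, and `ω₀` a
reduced word for `w₀`.  Label each covering relation `u ⋖ w` of the right weak
order by the reflection `w * u⁻¹`, and order the reflections by the heap poset
of `ω₀`.  Then in every non-square polygon of the weak order, one of the two
maximal chains has strictly increasing labels and the other strictly
decreasing labels. -/
theorem weak_order_labelling_polygonal {B W : Type*} [Group W]
    {M : CoxeterMatrix B} (cs : CoxeterSystem M W) [Finite W]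
    (w₀ : W) (hw₀ : ∀ w : W, cs.length w ≤ cs.length w₀)
    (ω₀ : List B) (hω₀ : cs.IsReduced ω₀) (hω₀p : cs.wordProd ω₀ = w₀)
    (x y : W) (C₁ C₂ : Set W)
    (hP : IsPolygonPair (weakLE cs) x y C₁ C₂)
    (hns : (IccR (weakLE cs) x y).ncard ≠ 4) :
    (ChainAscending (weakLE cs) (fun u w => w * u⁻¹) (heapLt cs ω₀) C₁ ∧
      ChainAscending (weakLE cs) (fun u w => w * u⁻¹)
        (fun a b => heapLt cs ω₀ b a) C₂) ∨
    (ChainAscending (weakLE cs) (fun u w => w * u⁻¹) (heapLt cs ω₀) C₂ ∧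
      ChainAscending (weakLE cs) (fun u w => w * u⁻¹)
        (fun a b => heapLt cs ω₀ b a) C₁) := by
  obtain ⟨i, hi, hi1, hi2⟩ := WOL.first_step cs hP
  obtain ⟨j, hj, hj1, hj2⟩ := WOL.first_step cs (WOL.pair_symm cs hP)
  have e1 := WOL.side_eq cs hP i j hi hj hi1 hi2 hj1 hj2
  have e2 := WOL.side_eq cs (WOL.pair_symm cs hP) j i hj hi hj1 hj2 hi1 hi2
  have hs := cs.simple_mul_simple_self i
  have ht := cs.simple_mul_simple_self j
  have n1 := WOL.side_ncard cs i j x hi hj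
  have n2 := WOL.side_ncard cs j i x hj hi
  rw [← e1] at n1
  rw [← e2, WOL.order_swap] at n2
  have hpos := orderOf_pos (cs.simple i * cs.simple j)
  have hm : 2 < orderOf (cs.simple i * cs.simple j) := by
    obtain ⟨hxy, hC₁, hC₂, hne, hun, hint, hall⟩ := hP
    have h1 : orderOf (cs.simple i * cs.simple j) ≠ 1 := by
      intro h
      rw [orderOf_eq_one_iff, mul_eq_one_iff_eq_inv, CoxeterSystem.inv_simple] at h
      rw [h] at hi1
      exact hj2 hi1
    have h2 : orderOf (cs.simple i * cs.simple j) ≠ 2 := by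
      intro h
      apply hns
      have hxy' : x ≠ y := by
        rintro rfl
        have := hC₁.1 hi1
        have := WOL.le_antisymm' cs this.1 this.2
        rw [← this] at hi1 hi2
        have h3 : x ∈ C₁ ∩ C₂ := by rw [hint]; simp
        exact hi2 h3.2
      have := Set.ncard_union_add_ncard_inter C₁ C₂
      rw [hint, Set.ncard_pair hxy', n1, n2, ← hun, h] at this
      omega
    omega
  have sw : ∀ R : W → W → Prop,
      (∀ l l', l < l' → l' < orderOf (cs.simple i * cs.simple j) →
        R (x * WOL.rr (cs.simple i) (cs.simple j) l' * x⁻¹)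
          (x * WOL.rr (cs.simple i) (cs.simple j) l * x⁻¹)) →
      (∀ l l', l < l' → l' < orderOf (cs.simple j * cs.simple i) →
        R (x * WOL.rr (cs.simple j) (cs.simple i) l * x⁻¹)
          (x * WOL.rr (cs.simple j) (cs.simple i) l' * x⁻¹)) := by
    intro R h l l' hl hl'
    rw [WOL.order_swap] at hl'
    rw [WOL.rr_swap hs ht (by omega), WOL.rr_swap hs ht (by omega)]
    exact h _ _ (by omega) (by omega)
  rcases WOL.positions cs i j x hi hj w₀ hw₀ ω₀ hω₀ hω₀p hm with h | h
  · left
    constructor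
    · rw [e1]; exact WOL.side_asc cs i j x hi hj _ h
    · rw [e2]; exact WOL.side_asc cs j i x hj hi _ (sw (fun a b => heapLt cs ω₀ b a) h)
  · right
    constructor
    · rw [e2]; exact WOL.side_asc cs j i x hj hi _ (sw _ h)
    · rw [e1]; exact WOL.side_asc cs i j x hi hj _ h
end

section
/- Let (W, S) be a finite Coxeter system with longest element w₀ and fix a reduced word ω₀ for w₀. Then the preorder ≼ on square-equivalence classes of maximal chains of the right weak order on W, generated by increasing polygon moves with respect to the heap poset heap(ω₀), is a partial order (i.e. it is antisymmetric). -/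
section Aux

open CoxeterSystem

variable {B : Type*} {W : Type*} [Group W] {M : CoxeterMatrix B}

open Classical in
/-- The generators of the signed reflection representation. -/
noncomputable def sgnF (cs : CoxeterSystem M W) (i : B) : Function.End (W × ZMod 2) :=
  fun p => (cs.simple i * p.1 * cs.simple i, p.2 + if p.1 = cs.simple i then 1 else 0)

lemma grp_aux {a b t : W} (hii : a⁻¹ = a) (hji : b⁻¹ = b) (m : ℕ) :
    (((a * b) ^ m * t * ((a * b) ^ m)⁻¹ = b) ↔ t = ((a * b)⁻¹) ^ (2 * m) * b) ∧
    ((b * ((a * b) ^ m * t * ((a * b) ^ m)⁻¹) * b = a) ↔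
        t = ((a * b)⁻¹) ^ (2 * m + 1) * b) := by
  have hr : SemiconjBy b (a * b) (a * b)⁻¹ := by
    rw [SemiconjBy, mul_inv_rev, hii, hji]
    simp only [mul_assoc]
  have hrm : ∀ k : ℕ, b * (a * b) ^ k = ((a * b)⁻¹) ^ k * b := fun k => (hr.pow_right k).eq
  have e1 : ((a * b) ^ m * t * ((a * b) ^ m)⁻¹ = b) ↔ t = ((a * b)⁻¹) ^ (2 * m) * b := by
    rw [mul_inv_eq_iff_eq_mul, hrm, ← eq_inv_mul_iff_mul_eq, two_mul, pow_add, inv_pow, mul_assoc]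
  have e2 : (b * ((a * b) ^ m * t * ((a * b) ^ m)⁻¹) * b = a) ↔
      t = ((a * b)⁻¹) ^ (2 * m + 1) * b := by
    have : b * ((a * b) ^ m * t * ((a * b) ^ m)⁻¹) * b = a ↔
        (a * b) ^ m * t * ((a * b) ^ m)⁻¹ = (a * b)⁻¹ * b := by
      rw [mul_inv_rev, hii, hji, ← eq_mul_inv_iff_mul_eq, hji, ← eq_inv_mul_iff_mul_eq, hji]
      simp only [mul_assoc]
    rw [this, mul_inv_eq_iff_eq_mul, mul_assoc, hrm, ← eq_inv_mul_iff_mul_eq]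
    rw [show 2 * m + 1 = m + (1 + m) by ring, pow_add, pow_add, pow_one, inv_pow]
    simp only [mul_assoc]
  exact ⟨e1, e2⟩

open Classical in
lemma sgnF_pow (cs : CoxeterSystem M W) (i j : B) (m : ℕ) (p : W × ZMod 2) :
    ((sgnF cs i * sgnF cs j) ^ m) p =
      ((cs.simple i * cs.simple j) ^ m * p.1 * ((cs.simple i * cs.simple j) ^ m)⁻¹,
        p.2 + ∑ k ∈ Finset.range (2 * m),
          if p.1 = ((cs.simple i * cs.simple j)⁻¹) ^ k * cs.simple j then 1 else 0) := by
  induction m with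
  | zero => simp; rfl
  | succ m ih =>
    rw [pow_succ']
    change sgnF cs i (sgnF cs j (((sgnF cs i * sgnF cs j) ^ m) p)) = _
    rw [ih]
    simp only [sgnF]
    have hji : (cs.simple j)⁻¹ = cs.simple j := cs.inv_simple j
    have hii : (cs.simple i)⁻¹ = cs.simple i := cs.inv_simple i
    obtain ⟨e1, e2⟩ := grp_aux (t := p.1) hii hji m
    rw [show 2 * (m + 1) = 2 * m + 1 + 1 by ring, Finset.sum_range_succ, Finset.sum_range_succ]
    simp only [e1, e2]
    ext
    · simp only [pow_succ', mul_inv_rev, hii, hji, mul_assoc]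
    · simp only [add_assoc]

open Classical in
lemma sgnF_liftable (cs : CoxeterSystem M W) : M.IsLiftable (sgnF cs) := by
  intro i j
  funext p
  rw [sgnF_pow]
  have h : (cs.simple i * cs.simple j) ^ M i j = 1 := cs.simple_mul_simple_pow i j
  have h' : ((cs.simple i * cs.simple j)⁻¹) ^ M i j = 1 := by rw [inv_pow, h, inv_one]
  rw [h, two_mul, Finset.sum_range_add]
  simp only [pow_add, h', one_mul]
  rw [CharTwo.add_self_eq_zero]
  simp
  rfl

open Classical in
lemma sgn_lift_word (cs : CoxeterSystem M W) (ω : List B) (t : W) (e : ZMod 2) :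
    (cs.lift ⟨sgnF cs, sgnF_liftable cs⟩ (cs.wordProd ω)) (t, e) =
      (cs.wordProd ω * t * (cs.wordProd ω)⁻¹, e + ((cs.rightInvSeq ω).count t : ZMod 2)) := by
  induction ω with
  | nil => simp; rfl
  | cons i ω ih =>
    rw [cs.wordProd_cons, map_mul, cs.lift_apply_simple]
    change sgnF cs i _ = _
    rw [ih]
    have : (cs.wordProd ω * t * (cs.wordProd ω)⁻¹ = cs.simple i) ↔
      ((cs.wordProd ω)⁻¹ * cs.simple i * cs.wordProd ω = t) := by
      constructor
      · intro h; rw [← h]; group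
      · intro h; rw [← h]; group
    simp only [sgnF, rightInvSeq, List.count_cons, this, beq_iff_eq]
    ext
    · simp [mul_assoc]
    · simp [add_assoc]

open Classical in
lemma count_eq (cs : CoxeterSystem M W) {ω ω' : List B} (h : cs.wordProd ω = cs.wordProd ω')
    (t : W) : ((cs.leftInvSeq ω).count t : ZMod 2) = ((cs.leftInvSeq ω').count t : ZMod 2) := by
  have h1 := sgn_lift_word cs ω.reverse t 0
  have h2 := sgn_lift_word cs ω'.reverse t 0
  rw [cs.wordProd_reverse] at h1 h2
  rw [h, h2, cs.rightInvSeq_reverse, cs.rightInvSeq_reverse] at h1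
  have := congrArg Prod.snd h1
  simpa using this.symm

/-- The left inversion set. -/
def NN (cs : CoxeterSystem M W) (w : W) : Set W :=
  {t | ∃ ω, cs.IsReduced ω ∧ w = cs.wordProd ω ∧ t ∈ cs.leftInvSeq ω}

lemma mem_NN (cs : CoxeterSystem M W) {ω : List B} (h : cs.IsReduced ω) (t : W) :
    t ∈ NN cs (cs.wordProd ω) ↔ t ∈ cs.leftInvSeq ω := by
  classical
  constructor
  · rintro ⟨ω', h', e, ht⟩
    have := count_eq cs e t
    rw [List.count_eq_one_of_mem h'.nodup_leftInvSeq ht] at this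
    by_contra hn
    rw [List.count_eq_zero_of_not_mem hn] at this
    simp at this
  · intro ht
    exact ⟨ω, h, rfl, ht⟩

lemma wle_refl (cs : CoxeterSystem M W) (u : W) : weakLE cs u u := by simp [weakLE]

lemma wle_trans (cs : CoxeterSystem M W) {u v w : W} (h1 : weakLE cs u v) (h2 : weakLE cs v w) :
    weakLE cs u w := by
  unfold weakLE at *
  have a := cs.length_mul_le (u⁻¹ * v) (v⁻¹ * w)
  have b := cs.length_mul_le u (u⁻¹ * w)
  rw [show u⁻¹ * v * (v⁻¹ * w) = u⁻¹ * w by group] at a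
  rw [show u * (u⁻¹ * w) = w by group] at b
  omega

lemma wle_eq (cs : CoxeterSystem M W) {u v : W} (h1 : weakLE cs u v)
    (h2 : cs.length v ≤ cs.length u) : u = v := by
  unfold weakLE at *
  have : cs.length (u⁻¹ * v) = 0 := by omega
  rw [cs.length_eq_zero_iff] at this
  exact inv_mul_eq_one.mp this

lemma wle_len (cs : CoxeterSystem M W) {u v : W} (h1 : weakLE cs u v) :
    cs.length u ≤ cs.length v := by
  unfold weakLE at *
  omega

lemma wle_antisymm (cs : CoxeterSystem M W) {u v : W} (h1 : weakLE cs u v)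
    (h2 : weakLE cs v u) : u = v := wle_eq cs h1 (wle_len cs h2)

lemma wle_simple (cs : CoxeterSystem M W) {u : W} {i : B}
    (h : cs.length (u * cs.simple i) = cs.length u + 1) : weakLE cs u (u * cs.simple i) := by
  simp [weakLE, h]

lemma cov_simple (cs : CoxeterSystem M W) {u : W} {i : B}
    (h : cs.length (u * cs.simple i) = cs.length u + 1) : CovR (weakLE cs) u (u * cs.simple i) := by
  refine ⟨wle_simple cs h, ?_, ?_⟩
  · intro e
    rw [← e] at h; omega
  · intro z h1 h2
    rcases Nat.lt_or_ge (cs.length u) (cs.length z) with h3 | h3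
    · right; exact wle_eq cs h2 (by omega)
    · left; exact (wle_eq cs h1 h3).symm

lemma cov_exists (cs : CoxeterSystem M W) {u w : W} (h : CovR (weakLE cs) u w) :
    ∃ i, w = u * cs.simple i ∧ cs.length w = cs.length u + 1 := by
  obtain ⟨h1, h2, h3⟩ := h
  have hne : u⁻¹ * w ≠ 1 := fun e => h2 (inv_mul_eq_one.mp e)
  obtain ⟨i, hi⟩ := cs.exists_leftDescent_of_ne_one hne
  rw [cs.isLeftDescent_iff] at hi
  have e : (u * cs.simple i)⁻¹ * w = cs.simple i * (u⁻¹ * w) := by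
    simp [mul_assoc]
  have a := cs.length_mul_le (u * cs.simple i) ((u * cs.simple i)⁻¹ * w)
  rw [mul_inv_cancel_left, e] at a
  have b := cs.length_mul_simple u i
  unfold weakLE at h1
  have hl : cs.length (u * cs.simple i) = cs.length u + 1 := by omega
  rcases h3 (u * cs.simple i) (wle_simple cs hl) (by unfold weakLE; rw [e]; omega) with h4 | h4
  · rw [h4] at hl; omega
  · exact ⟨i, h4.symm, by rw [← h4, hl]⟩

lemma NN_mono (cs : CoxeterSystem M W) {u w : W} (h : weakLE cs u w) : NN cs u ⊆ NN cs w := by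
  obtain ⟨ω1, r1, e1⟩ := cs.exists_isReduced u
  obtain ⟨ω2, r2, e2⟩ := cs.exists_isReduced (u⁻¹ * w)
  have e : w = cs.wordProd (ω1 ++ ω2) := by
    rw [cs.wordProd_append, ← e1, ← e2]; group
  have r : cs.IsReduced (ω1 ++ ω2) := by
    unfold CoxeterSystem.IsReduced at *
    unfold weakLE at h
    rw [← e, List.length_append, ← r1, ← r2, ← e1, ← e2, h]
  intro t ht
  rw [e, mem_NN cs r]
  rw [e1, mem_NN cs r1] at ht
  have := cs.leftInvSeq_take (ω1 ++ ω2) ω1.length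
  rw [List.take_left] at this
  rw [this] at ht
  exact List.mem_of_mem_take ht

lemma NN_cov (cs : CoxeterSystem M W) {u w : W} (h : CovR (weakLE cs) u w) :
    w * u⁻¹ ∉ NN cs u ∧ ∀ t, t ∈ NN cs w ↔ t ∈ NN cs u ∨ t = w * u⁻¹ := by
  obtain ⟨i, hi, hl⟩ := cov_exists cs h
  obtain ⟨ω, r, e⟩ := cs.exists_isReduced u
  have e' : w = cs.wordProd (ω.concat i) := by
    rw [cs.wordProd_concat, ← e, hi]
  have r' : cs.IsReduced (ω.concat i) := by
    unfold CoxeterSystem.IsReduced at *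
    rw [← e', List.length_concat, ← r, ← e, hl]
  have hs := cs.leftInvSeq_concat ω i
  rw [← e, ← hi] at hs
  have hn := r'.nodup_leftInvSeq
  rw [hs, List.concat_eq_append, List.nodup_append] at hn
  constructor
  · rw [e, mem_NN cs r, ← e]
    intro hm
    exact hn.2.2 _ hm _ (by simp) rfl
  · intro t
    rw [e', mem_NN cs r', hs, ← e', e, mem_NN cs r]
    simp


lemma chain_tot (cs : CoxeterSystem M W) {C : Set W} (h : IsChain (weakLE cs) C) {a b : W}
    (ha : a ∈ C) (hb : b ∈ C) : weakLE cs a b ∨ weakLE cs b a := by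
  by_cases e : a = b
  · subst e; exact Or.inl (wle_refl cs a)
  · exact h ha hb e

lemma cover_cases (cs : CoxeterSystem M W) {C : Set W} (h : IsChain (weakLE cs) C) {a b x : W}
    (ha : a ∈ C) (hb : b ∈ C) (hx : x ∈ C) (hc : CovR (weakLE cs) a b) :
    weakLE cs b x ∨ weakLE cs x a := by
  rcases chain_tot cs h ha hx with h1 | h1
  · rcases chain_tot cs h hb hx with h2 | h2
    · exact Or.inl h2
    · rcases hc.2.2 x h1 h2 with rfl | rfl
      · exact Or.inr (wle_refl cs _)
      · exact Or.inl (wle_refl cs _)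
  · exact Or.inr h1

lemma maxchain_label (cs : CoxeterSystem M W) [Finite W] {P : Set W} {x y t : W}
    (hP : MaxChainIn (weakLE cs) (IccR (weakLE cs) x y) P) (hx : x ∈ P) (hy : y ∈ P)
    (ht : t ∈ NN cs y) (ht' : t ∉ NN cs x) :
    ∃ a b, a ∈ P ∧ b ∈ P ∧ CovR (weakLE cs) a b ∧ t = b * a⁻¹ := by
  obtain ⟨hsub, hch, hmax⟩ := hP
  obtain ⟨a, ⟨haP, hat⟩, ha⟩ := Set.exists_max_image {z | z ∈ P ∧ t ∉ NN cs z} cs.length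
    (Set.toFinite _) ⟨x, hx, ht'⟩
  obtain ⟨b, ⟨hbP, hbt⟩, hb⟩ := Set.exists_min_image {z | z ∈ P ∧ t ∈ NN cs z} cs.length
    (Set.toFinite _) ⟨y, hy, ht⟩
  have hlow : ∀ p ∈ P, t ∉ NN cs p → weakLE cs p a := by
    intro p hp hpt
    rcases chain_tot cs hch hp haP with h | h
    · exact h
    · rw [wle_eq cs h (ha p ⟨hp, hpt⟩)]; exact wle_refl cs _
  have hhigh : ∀ p ∈ P, t ∈ NN cs p → weakLE cs b p := by
    intro p hp hpt
    rcases chain_tot cs hch hp hbP with h | h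
    · rw [wle_eq cs h (hb p ⟨hp, hpt⟩)]; exact wle_refl cs _
    · exact h
  have hab : weakLE cs a b := by
    rcases chain_tot cs hch haP hbP with h | h
    · exact h
    · exact absurd (NN_mono cs h hbt) hat
  have hcov : CovR (weakLE cs) a b := by
    refine ⟨hab, ?_, ?_⟩
    · rintro rfl; exact hat hbt
    · intro z h1 h2
      have hzP : z ∈ P := by
        have := hmax (insert z P) ?_ ?_ (Set.subset_insert z P)
        · rw [this]; exact Set.mem_insert z P
        · refine Set.insert_subset ⟨wle_trans cs (hsub haP).1 h1, wle_trans cs h2 (hsub hbP).2⟩ hsub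
        · refine hch.insert ?_
          intro p hp _
          by_cases hpt : t ∈ NN cs p
          · exact Or.inl (wle_trans cs h2 (hhigh p hp hpt))
          · exact Or.inr (wle_trans cs (hlow p hp hpt) h1)
      by_cases hzt : t ∈ NN cs z
      · exact Or.inr (wle_antisymm cs h2 (hhigh z hzP hzt))
      · exact Or.inl (wle_antisymm cs (hlow z hzP hzt) h1)
  refine ⟨a, b, haP, hbP, hcov, ?_⟩
  rcases ((NN_cov cs hcov).2 t).1 hbt with h | h
  · exact absurd h hat
  · exact h

lemma poly_symm {r : W → W → Prop} {x y : W} {P₁ P₂ : Set W} (h : IsPolygonPair r x y P₁ P₂) :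
    IsPolygonPair r x y P₂ P₁ := by
  obtain ⟨h1, h2, h3, h4, h5, h6, h7⟩ := h
  exact ⟨h1, h3, h2, h4.symm, by rw [h5, Set.union_comm], by rw [Set.inter_comm, h6],
    fun C hC => (h7 C hC).symm⟩

lemma poly_mem {r : W → W → Prop} {x y : W} {P₁ P₂ : Set W} (h : IsPolygonPair r x y P₁ P₂) :
    x ∈ P₁ ∧ y ∈ P₁ := by
  obtain ⟨h1, h2, h3, h4, h5, h6, h7⟩ := h
  have hx : x ∈ P₁ ∩ P₂ := by rw [h6]; simp
  have hy : y ∈ P₁ ∩ P₂ := by rw [h6]; simp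
  exact ⟨hx.1, hy.1⟩

lemma poly_label (cs : CoxeterSystem M W) [Finite W] {x y : W} {P₁ P₂ : Set W}
    (h : IsPolygonPair (weakLE cs) x y P₁ P₂) {a b : W} (ha : a ∈ P₁) (hb : b ∈ P₁)
    (hc : CovR (weakLE cs) a b) :
    ∃ a' b', a' ∈ P₂ ∧ b' ∈ P₂ ∧ CovR (weakLE cs) a' b' ∧ b * a⁻¹ = b' * a'⁻¹ := by
  have hm := poly_mem (poly_symm h)
  obtain ⟨h1, h2, h3, h4, h5, h6, h7⟩ := h
  have hN := NN_cov cs hc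
  refine maxchain_label cs h3 hm.1 hm.2 ?_ ?_
  · exact NN_mono cs (h2.1 hb).2 ((hN.2 _).2 (Or.inr rfl))
  · exact fun hh => hN.1 (NN_mono cs (h2.1 ha).1 hh)

lemma poly_inside (cs : CoxeterSystem M W) {x y z : W} {P₁ P₂ C : Set W}
    (h : IsPolygonPair (weakLE cs) x y P₁ P₂) (hC : IsChain (weakLE cs) C) (hP : P₁ ⊆ C)
    (hz : z ∈ C) (h1 : weakLE cs x z) (h2 : weakLE cs z y) : z ∈ P₁ := by
  have := h.2.1.2.2 (insert z P₁) (Set.insert_subset ⟨h1, h2⟩ h.2.1.1)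
    (hC.mono (Set.insert_subset hz hP)) (Set.subset_insert z P₁)
  rw [this]; exact Set.mem_insert z P₁

lemma poly_outside (cs : CoxeterSystem M W) {x y z : W} {P₁ P₂ C C' : Set W}
    (h : IsPolygonPair (weakLE cs) x y P₁ P₂) (hP' : P₂ ⊆ C')
    (hd : C \ P₁ = C' \ P₂) (hz : z ∈ C)
    (hzz : weakLE cs z x ∨ weakLE cs y z) : z ∈ C' := by
  have hm := poly_mem (poly_symm h)
  by_cases hzP : z ∈ P₁
  · have hi := h.2.1.1 hzP
    rcases hzz with h1 | h1
    · rw [wle_antisymm cs h1 hi.1]; exact hP' hm.1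
    · rw [← wle_antisymm cs h1 hi.2]; exact hP' hm.2
  · have : z ∈ C \ P₁ := ⟨hz, hzP⟩
    rw [hd] at this
    exact this.1

lemma poly_chain (cs : CoxeterSystem M W) {x y : W} {P₁ P₂ C C' : Set W}
    (h : IsPolygonPair (weakLE cs) x y P₁ P₂) (hC : IsChain (weakLE cs) C) (hP : P₁ ⊆ C)
    (hd : C \ P₁ = C' \ P₂) : IsChain (weakLE cs) C' := by
  have hm := poly_mem h
  have key : ∀ z, z ∈ C' → z ∉ P₂ → z ∈ C ∧ (weakLE cs z x ∨ weakLE cs y z) := by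
    intro z hz hz2
    have hz' : z ∈ C \ P₁ := by rw [hd]; exact ⟨hz, hz2⟩
    refine ⟨hz'.1, ?_⟩
    rcases chain_tot cs hC hz'.1 (hP hm.1) with h1 | h1
    · exact Or.inl h1
    · rcases chain_tot cs hC hz'.1 (hP hm.2) with h2 | h2
      · exact absurd (poly_inside cs h hC hP hz'.1 h1 h2) hz'.2
      · exact Or.inr h2
  intro a ha b hb hab
  by_cases ha2 : a ∈ P₂
  · have hia := h.2.2.1.1 ha2
    by_cases hb2 : b ∈ P₂
    · exact h.2.2.1.2.1 ha2 hb2 hab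
    · rcases (key b hb hb2).2 with h1 | h1
      · exact Or.inr (wle_trans cs h1 hia.1)
      · exact Or.inl (wle_trans cs hia.2 h1)
  · by_cases hb2 : b ∈ P₂
    · have hib := h.2.2.1.1 hb2
      rcases (key a ha ha2).2 with h1 | h1
      · exact Or.inl (wle_trans cs h1 hib.1)
      · exact Or.inr (wle_trans cs hib.2 h1)
    · exact hC (key a ha ha2).1 (key b hb hb2).1 hab

lemma poly_before (cs : CoxeterSystem M W) [Finite W] {x y : W} {P₁ P₂ C C' : Set W}
    (h : IsPolygonPair (weakLE cs) x y P₁ P₂) (hC : IsChain (weakLE cs) C) (hP : P₁ ⊆ C)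
    (hP' : P₂ ⊆ C') (hd : C \ P₁ = C' \ P₂) {t t' : W} (hb : chainBefore cs C t t') :
    chainBefore cs C' t t' ∨ chainBefore cs P₁ t t' := by
  have hm := poly_mem h
  have key : ∀ a b, a ∈ C → b ∈ C → CovR (weakLE cs) a b →
      (weakLE cs b x ∧ a ∈ C' ∧ b ∈ C') ∨ (weakLE cs y a ∧ a ∈ C' ∧ b ∈ C') ∨
      (a ∈ P₁ ∧ b ∈ P₁) := by
    intro a b ha hb hab
    rcases cover_cases cs hC ha hb (hP hm.1) hab with h1 | h1
    · exact Or.inl ⟨h1, poly_outside cs h hP' hd ha (Or.inl (wle_trans cs hab.1 h1)),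
        poly_outside cs h hP' hd hb (Or.inl h1)⟩
    rcases cover_cases cs hC ha hb (hP hm.2) hab with h2 | h2
    · exact Or.inr (Or.inr ⟨poly_inside cs h hC hP ha h1 (wle_trans cs hab.1 h2),
        poly_inside cs h hC hP hb (wle_trans cs h1 hab.1) h2⟩)
    · exact Or.inr (Or.inl ⟨h2, poly_outside cs h hP' hd ha (Or.inr h2),
        poly_outside cs h hP' hd hb (Or.inr (wle_trans cs h2 hab.1))⟩)
  obtain ⟨a, b, c, d, ha, hb, hc, hd', hab, hcd, rfl, rfl, hbc⟩ := hb
  rcases or_assoc.2 (key a b ha hb hab) with h1 | h1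
  · have h1' : a ∈ C' ∧ b ∈ C' := by rcases h1 with h1 | h1 <;> exact h1.2
    rcases or_assoc.2 (key c d hc hd' hcd) with h2 | h2
    · have h2' : c ∈ C' ∧ d ∈ C' := by rcases h2 with h2 | h2 <;> exact h2.2
      exact Or.inl ⟨a, b, c, d, h1'.1, h1'.2, h2'.1, h2'.2, hab, hcd, rfl, rfl, hbc⟩
    · obtain ⟨c', d', hc', hd'', hcd', e⟩ := poly_label cs h h2.1 h2.2 hcd
      refine Or.inl ⟨a, b, c', d', h1'.1, h1'.2, hP' hc', hP' hd'', hab, hcd', rfl, e, ?_⟩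
      rcases h1 with h1 | h1
      · exact wle_trans cs h1.1 (h.2.2.1.1 hc').1
      · exact absurd (wle_antisymm cs hab.1
          (wle_trans cs hbc (wle_trans cs (h.2.1.1 h2.1).2 h1.1))) hab.2.1
  · obtain ⟨a', b', ha', hb', hab', e⟩ := poly_label cs h h1.1 h1.2 hab
    rcases or_assoc.2 (key c d hc hd' hcd) with h2 | h2
    · have h2' : c ∈ C' ∧ d ∈ C' := by rcases h2 with h2 | h2 <;> exact h2.2
      refine Or.inl ⟨a', b', c, d, hP' ha', hP' hb', h2'.1, h2'.2, hab', hcd, e, rfl, ?_⟩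
      rcases h2 with h2 | h2
      · exact absurd (wle_antisymm cs hcd.1
          (wle_trans cs h2.1 (wle_trans cs (h.2.1.1 h1.2).1 hbc))) hcd.2.1
      · exact wle_trans cs (h.2.2.1.1 hb').2 h2.1
    · exact Or.inr ⟨a, b, c, d, h1.1, h1.2, h2.1, h2.2, hab, hcd, rfl, rfl, hbc⟩

lemma before_asymm (cs : CoxeterSystem M W) {C : Set W} (hC : IsChain (weakLE cs) C) {t t' : W}
    (h1 : chainBefore cs C t t') (h2 : chainBefore cs C t' t) : False := by
  obtain ⟨p, q, r, s, hp, hq, hr, hs, hpq, hrs, rfl, rfl, hqr⟩ := h1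
  obtain ⟨p2, q2, r2, s2, hp2, hq2, hr2, hs2, hpq2, hrs2, e1, e2, hqr2⟩ := h2
  have n1 := (NN_cov cs hpq)
  have n2 := (NN_cov cs hrs)
  have n3 := (NN_cov cs hpq2)
  have n4 := (NN_cov cs hrs2)
  rcases cover_cases cs hC hp hq hr2 hpq with h | h
  · have := NN_mono cs h ((n1.2 _).2 (Or.inr rfl))
    rw [e2] at this
    exact n4.1 this
  · have := NN_mono cs (wle_trans cs (wle_trans cs hqr2 h) (wle_trans cs hpq.1 hqr))
      ((n3.2 _).2 (Or.inr rfl))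
    rw [← e1] at this
    exact n2.1 this

lemma cov_min (cs : CoxeterSystem M W) {P : Set W} (hP : IsChain (weakLE cs) P) {a b c : W}
    (hb : b ∈ P) (hc : c ∈ P) (hab : CovR (weakLE cs) a b) (hac : weakLE cs a c) (hne : a ≠ c) :
    weakLE cs b c := by
  rcases chain_tot cs hP hb hc with h | h
  · exact h
  · rcases hab.2.2 c hac h with e | e
    · exact absurd e.symm hne
    · rw [e]; exact wle_refl cs _

lemma three_of_covers (cs : CoxeterSystem M W) {P : Set W} {x y p : W}
    (hP : IsChain (weakLE cs) P) (hsub : P ⊆ IccR (weakLE cs) x y) (hp : p ∈ P)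
    (h1 : CovR (weakLE cs) x p) (h2 : CovR (weakLE cs) p y) : P ⊆ {x, p, y} := by
  intro z hz
  rcases chain_tot cs hP hz hp with h | h
  · rcases h1.2.2 z (hsub hz).1 h with e | e <;> simp [e]
  · rcases h2.2.2 z h (hsub hz).2 with e | e <;> simp [e]

lemma square_comm (cs : CoxeterSystem M W) [Finite W] {x y : W} {P₁ P₂ : Set W}
    (h : IsPolygonPair (weakLE cs) x y P₁ P₂) (h4 : (IccR (weakLE cs) x y).ncard = 4) {t t' : W}
    (hb : chainBefore cs P₁ t t') : t * t' = t' * t := by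
  obtain ⟨a, p, c, d, ha, hp, hc, hd, hap, hcd, rfl, rfl, hpc⟩ := hb
  have hm := poly_mem h
  have hm2 := poly_mem (poly_symm h)
  obtain ⟨g1, g2, g3, g4, g5, g6, g7⟩ := id h
  have hxy : x ≠ y := by
    rintro rfl
    have := wle_antisymm cs (wle_trans cs (wle_trans cs hpc hcd.1) (g2.1 hd).2)
      (wle_trans cs (g2.1 ha).1 hap.1)
    exact hap.2.1 (wle_antisymm cs hap.1 (wle_trans cs (g2.1 hp).2 (g2.1 ha).1))
  have hcard := Set.ncard_union_add_ncard_inter P₁ P₂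
  rw [← g5, g6, h4, Set.ncard_pair hxy] at hcard
  -- both have at least three elements
  have hpx : p ≠ x := by
    rintro rfl
    exact hap.2.1 (wle_antisymm cs hap.1 (g2.1 ha).1)
  have hpy : p ≠ y := by
    rintro rfl
    exact hcd.2.1 (wle_antisymm cs hcd.1 (wle_trans cs (g2.1 hd).2 hpc))
  obtain ⟨q, hq, hqx, hqy⟩ : ∃ q ∈ P₂, q ≠ x ∧ q ≠ y := by
    by_contra hcon
    push Not at hcon
    have : P₂ ⊆ P₁ := by
      intro z hz
      by_cases hzx : z = x
      · rw [hzx]; exact hm.1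
      · rw [hcon z hz hzx]; exact hm.2
    exact g4 (g3.2.2 P₁ g2.1 g2.2.1 this).symm
  have c1 : ({x, p, y} : Set W).ncard = 3 := by
    rw [Set.ncard_eq_three]; exact ⟨x, p, y, hpx.symm, hxy, hpy, rfl⟩
  have c2 : ({x, q, y} : Set W).ncard = 3 := by
    rw [Set.ncard_eq_three]; exact ⟨x, q, y, hqx.symm, hxy, hqy, rfl⟩
  have s1 : ({x, p, y} : Set W) ⊆ P₁ := by
    intro z hz; rcases hz with rfl | rfl | rfl; exacts [hm.1, hp, hm.2]
  have s2 : ({x, q, y} : Set W) ⊆ P₂ := by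
    intro z hz; rcases hz with rfl | rfl | rfl; exacts [hm2.1, hq, hm2.2]
  have d1 := Set.ncard_le_ncard s1
  have d2 := Set.ncard_le_ncard s2
  have e1 : {x, p, y} = P₁ := Set.eq_of_subset_of_ncard_le s1 (by omega)
  have e2 : {x, q, y} = P₂ := Set.eq_of_subset_of_ncard_le s2 (by omega)
  have hpq : p ≠ q := by
    rintro rfl
    exact g4 (e1.symm.trans e2)
  have ipx := g2.1 hp
  have iqx := g3.1 hq
  have hcov : ∀ u v, u ∈ P₂ → v ∈ P₂ → CovR (weakLE cs) u v → (u = x ∧ v = q) ∨ (u = q ∧ v = y) := by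
    intro u v hu hv huv
    have nxy : ¬ CovR (weakLE cs) x y := by
      intro hh
      rcases hh.2.2 p ipx.1 ipx.2 with h | h
      · exact hpx h
      · exact hpy h
    rw [← e2] at hu hv
    have iu := huv.1
    have nu := huv.2.1
    rcases hu with rfl | rfl | rfl <;> rcases hv with rfl | rfl | rfl
    · exact absurd rfl nu
    · exact Or.inl ⟨rfl, rfl⟩
    · exact absurd huv nxy
    · exact absurd (wle_antisymm cs iu iqx.1) nu
    · exact absurd rfl nu
    · exact Or.inr ⟨rfl, rfl⟩
    · exact absurd (wle_antisymm cs iu g1) nu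
    · exact absurd (wle_antisymm cs iu iqx.2) nu
    · exact absurd rfl nu
  have hax : a = x := by
    have := ha
    rw [← e1] at this
    rcases this with rfl | rfl | rfl
    · rfl
    · exact absurd rfl hap.2.1
    · exact absurd (wle_antisymm cs hap.1 ipx.2) hap.2.1
  have hdy : d = y := by
    have := hd
    rw [← e1] at this
    rcases this with rfl | rfl | rfl
    · exact absurd (wle_antisymm cs (wle_trans cs hpc hcd.1) ipx.1) hpx
    · exact absurd (wle_antisymm cs hcd.1 hpc) hcd.2.1
    · rfl
  have hcp : c = p := by
    have := hc
    rw [← e1] at this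
    rcases this with rfl | rfl | rfl
    · exact absurd (wle_antisymm cs hpc ipx.1) hpx
    · rfl
    · exact absurd hdy.symm hcd.2.1
  subst hax hdy hcp
  obtain ⟨u, v, hu, hv, huv, el⟩ := poly_label cs h ha hp hap
  obtain ⟨u', v', hu', hv', huv', el'⟩ := poly_label cs h hp hd hcd
  have f1 : c * a⁻¹ = d * q⁻¹ := by
    rcases hcov u v hu hv huv with ⟨rfl, rfl⟩ | ⟨rfl, rfl⟩
    · exact absurd (mul_right_cancel el) hpq
    · exact el
  have f2 : d * c⁻¹ = q * a⁻¹ := by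
    rcases hcov u' v' hu' hv' huv' with ⟨rfl, rfl⟩ | ⟨rfl, rfl⟩
    · exact el'
    · exact absurd (inv_injective (mul_left_cancel el')) hpq
  calc c * a⁻¹ * (d * c⁻¹) = d * q⁻¹ * (q * a⁻¹) := by rw [f1, f2]
    _ = d * a⁻¹ := by group
    _ = d * c⁻¹ * (c * a⁻¹) := by group

lemma exists_maxchain [Finite W] (r : W → W → Prop) (S C : Set W) (h1 : C ⊆ S)
    (h2 : IsChain r C) : ∃ D, C ⊆ D ∧ MaxChainIn r S D := by
  obtain ⟨D, hCD, hD⟩ := (Set.toFinite {D : Set W | D ⊆ S ∧ IsChain r D}).exists_le_maximal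
    (a := C) ⟨h1, h2⟩
  refine ⟨D, hCD, hD.prop.1, hD.prop.2, ?_⟩
  intro C' a b c
  exact le_antisymm c (hD.le_of_ge ⟨a, b⟩ c)

lemma nonsquare_noncomm (cs : CoxeterSystem M W) [Finite W] {x y : W} {P₁ P₂ : Set W}
    (h : IsPolygonPair (weakLE cs) x y P₁ P₂) (h4 : (IccR (weakLE cs) x y).ncard ≠ 4) {a b c : W}
    (ha : a ∈ P₁) (hb : b ∈ P₁) (hc : c ∈ P₁) (hab : CovR (weakLE cs) a b)
    (hbc : CovR (weakLE cs) b c) : (b * a⁻¹) * (c * b⁻¹) ≠ (c * b⁻¹) * (b * a⁻¹) := by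
  intro hcomm
  obtain ⟨i, hi, hil⟩ := cov_exists cs hab
  obtain ⟨j, hj, hjl⟩ := cov_exists cs hbc
  obtain ⟨g1, g2, g3, g4, g5, g6, g7⟩ := id h
  have hsi : cs.simple i * cs.simple i = 1 := cs.simple_mul_simple_self i
  have hsii : (cs.simple i)⁻¹ = cs.simple i := cs.inv_simple i
  have hcm : cs.simple j * cs.simple i = cs.simple i * cs.simple j := by
    rw [hj, hi] at hcomm
    simp only [mul_inv_rev, hsii, mul_assoc, inv_mul_cancel_left, mul_right_inj] at hcomm
    rw [← mul_assoc (cs.simple i) (cs.simple i), hsi, one_mul] at hcomm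
    simp only [← mul_assoc, mul_left_inj] at hcomm
    rw [mul_assoc] at hcomm
    calc cs.simple j * cs.simple i
        = cs.simple i * (cs.simple i * (cs.simple j * cs.simple i)) := by
          rw [← mul_assoc (cs.simple i) (cs.simple i), hsi, one_mul]
      _ = cs.simple i * cs.simple j := by rw [hcomm]
  have hc' : c = a * cs.simple j * cs.simple i := by
    rw [hj, hi, mul_assoc, mul_assoc, hcm]
  have l1 := cs.length_mul_simple a j
  have l2 := cs.length_mul_simple (a * cs.simple j) i
  rw [← hc'] at l2
  have l3 : cs.length (a * cs.simple j) = cs.length a + 1 := by omega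
  have k1 := cov_simple cs l3
  have k2 : CovR (weakLE cs) (a * cs.simple j) c := by
    rw [hc']; apply cov_simple; rw [← hc']; omega
  set b' := a * cs.simple j with hb'
  have hbb : b' ≠ b := by
    intro e
    have hca : c = a := by
      rw [hj, ← e, hb', mul_assoc, cs.simple_mul_simple_self, mul_one]
    rw [hca] at hjl
    omega
  have hIb : b' ∈ IccR (weakLE cs) x y :=
    ⟨wle_trans cs (g2.1 ha).1 k1.1, wle_trans cs k2.1 (g2.1 hc).2⟩
  have hb1 : b' ∉ P₁ := by
    intro hm
    rcases chain_tot cs g2.2.1 hm hb with h | h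
    · exact hbb (wle_eq cs h (by omega))
    · exact hbb (wle_eq cs h (by omega)).symm
  have hac := wle_trans cs hab.1 hbc.1
  have hchain : IsChain (weakLE cs) {a, b', c} := by
    intro u hu v hv _
    rcases hu with rfl | rfl | rfl <;> rcases hv with rfl | rfl | rfl <;>
      first
      | exact Or.inl (wle_refl cs _)
      | exact Or.inl hac
      | exact Or.inr hac
      | exact Or.inl k1.1
      | exact Or.inr k1.1
      | exact Or.inl k2.1
      | exact Or.inr k2.1
  obtain ⟨D, hD, hDm⟩ := exists_maxchain (weakLE cs) (IccR (weakLE cs) x y) {a, b', c} (by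
    intro u hu
    rcases hu with rfl | rfl | rfl
    · exact g2.1 ha
    · exact hIb
    · exact g2.1 hc) hchain
  have hD2 : D = P₂ := by
    rcases g7 D hDm with e | e
    · exact absurd (by rw [← e]; exact hD (by simp)) hb1
    · exact e
  subst hD2
  have ha2 : a ∈ P₁ ∩ D := ⟨ha, hD (by simp)⟩
  have hc2 : c ∈ P₁ ∩ D := ⟨hc, hD (by simp)⟩
  rw [g6] at ha2 hc2
  have hne : a ≠ c := by
    intro e; rw [← e] at hjl; omega
  have hax : a = x ∧ c = y := by
    rcases ha2 with e | e <;> rcases hc2 with e' | e'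
    · exact absurd (e.trans e'.symm) hne
    · exact ⟨e, e'⟩
    · exact absurd (wle_antisymm cs hac (by rw [e, e']; exact g1)) hne
    · exact absurd (e.trans e'.symm) hne
  obtain ⟨rfl, rfl⟩ := hax
  have s1 := three_of_covers cs g2.2.1 g2.1 hb hab hbc
  have s2 := three_of_covers cs g3.2.1 g3.1 (hD (by simp)) k1 k2
  apply h4
  have : IccR (weakLE cs) a c = {a, b, b', c} := by
    apply Set.Subset.antisymm
    · rw [g5]
      apply Set.union_subset
      · refine s1.trans ?_
        intro z hz; rcases hz with rfl | rfl | rfl <;> simp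
      · refine s2.trans ?_
        intro z hz; rcases hz with rfl | rfl | rfl <;> simp
    · intro z hz
      rcases hz with rfl | rfl | rfl | rfl
      · exact g2.1 ha
      · exact g2.1 hb
      · exact hIb
      · exact g2.1 hc
  rw [this]
  rw [Set.ncard_insert_of_notMem, Set.ncard_insert_of_notMem, Set.ncard_pair k2.2.1]
  · simp [hbb.symm, hbc.2.1]
  · simp [hab.2.1, k1.2.1, hne]

lemma nonsquare_swap (cs : CoxeterSystem M W) [Finite W] {x y : W} {P₁ P₂ : Set W}
    (h : IsPolygonPair (weakLE cs) x y P₁ P₂) :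
    ∃ a b c, a ∈ P₁ ∧ b ∈ P₁ ∧ c ∈ P₁ ∧ CovR (weakLE cs) a b ∧ CovR (weakLE cs) b c ∧
      chainBefore cs P₂ (c * b⁻¹) (b * a⁻¹) := by
  have hm := poly_mem h
  have hm2 := poly_mem (poly_symm h)
  obtain ⟨g1, g2, g3, g4, g5, g6, g7⟩ := id h
  have hxy : x ≠ y := by
    rintro rfl
    apply g4
    have e : ∀ P, P ⊆ IccR (weakLE cs) x x → x ∈ P → P = {x} := by
      intro P hP hx
      apply Set.Subset.antisymm
      · intro z hz
        exact (wle_antisymm cs (hP hz).1 (hP hz).2).symm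
      · intro z hz; rw [hz]; exact hx
    rw [e _ g2.1 hm.1, e _ g3.1 hm2.1]
  -- every non-top element of a maximal chain is covered, every non-bottom element covers
  have up : ∀ {P : Set W}, MaxChainIn (weakLE cs) (IccR (weakLE cs) x y) P → x ∈ P → y ∈ P →
      ∃ q ∈ P, CovR (weakLE cs) x q := by
    intro P hP hx hy
    obtain ⟨q, ⟨hq, hqx⟩, hmin⟩ := Set.exists_min_image {z | z ∈ P ∧ z ≠ x} cs.length
      (Set.toFinite _) ⟨y, hy, hxy.symm⟩
    have hlow : ∀ z ∈ P, z ≠ x → weakLE cs q z := by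
      intro z hz hzx
      rcases chain_tot cs hP.2.1 hq hz with h | h
      · exact h
      · rw [wle_eq cs h (hmin z ⟨hz, hzx⟩)]; exact wle_refl cs _
    refine ⟨q, hq, (hP.1 hq).1, hqx.symm, ?_⟩
    intro z h1 h2
    by_cases hzx : z = x
    · exact Or.inl hzx
    right
    have hzP : z ∈ P := by
      have := hP.2.2 (insert z P)
        (Set.insert_subset ⟨h1, wle_trans cs h2 (hP.1 hq).2⟩ hP.1) ?_ (Set.subset_insert z P)
      · rw [this]; exact Set.mem_insert z P
      · refine hP.2.1.insert ?_
        intro p hp _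
        by_cases hpx : p = x
        · rw [hpx]; exact Or.inr h1
        · exact Or.inl (wle_trans cs h2 (hlow p hp hpx))
    exact wle_antisymm cs h2 (hlow z hzP hzx)
  have down : ∀ {P : Set W}, MaxChainIn (weakLE cs) (IccR (weakLE cs) x y) P → x ∈ P →
      ∀ b ∈ P, b ≠ x → ∃ a ∈ P, CovR (weakLE cs) a b := by
    intro P hP hx b hb hbx
    obtain ⟨a, ⟨ha, hab, hne⟩, hmax⟩ := Set.exists_max_image
      {z | z ∈ P ∧ weakLE cs z b ∧ z ≠ b} cs.length
      (Set.toFinite _) ⟨x, hx, (hP.1 hb).1, hbx.symm⟩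
    have hhigh : ∀ z ∈ P, weakLE cs z b → z ≠ b → weakLE cs z a := by
      intro z hz hzb hzn
      rcases chain_tot cs hP.2.1 hz ha with h | h
      · exact h
      · rw [wle_eq cs h (hmax z ⟨hz, hzb, hzn⟩)]; exact wle_refl cs _
    refine ⟨a, ha, hab, hne, ?_⟩
    intro z h1 h2
    by_cases hzx : z = b
    · exact Or.inr hzx
    left
    have hzP : z ∈ P := by
      have := hP.2.2 (insert z P)
        (Set.insert_subset ⟨wle_trans cs (hP.1 ha).1 h1, wle_trans cs h2 (hP.1 hb).2⟩ hP.1) ?_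
        (Set.subset_insert z P)
      · rw [this]; exact Set.mem_insert z P
      · refine hP.2.1.insert ?_
        intro p hp _
        rcases chain_tot cs hP.2.1 hp hb with h | h
        · by_cases hpb : p = b
          · rw [hpb]; exact Or.inl h2
          · exact Or.inr (wle_trans cs (hhigh p hp h hpb) h1)
        · exact Or.inl (wle_trans cs h2 h)
    exact wle_antisymm cs (hhigh z hzP h2 hzx) h1
  obtain ⟨q, hq, hxq⟩ := up g3 hm2.1 hm2.2
  obtain ⟨b, c, hb, hc, hbc, el⟩ := poly_label cs (poly_symm h) hm2.1 hq hxq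
  have hqP : q ∉ P₁ := by
    intro hqP
    have : q ∈ P₁ ∩ P₂ := ⟨hqP, hq⟩
    rw [g6] at this
    rcases this with e | e
    · exact hxq.2.1 e.symm
    · apply g4
      have e' : ∀ P, P ⊆ IccR (weakLE cs) x y → x ∈ P → y ∈ P → P = {x, y} := by
        intro P hP hx hy
        apply Set.Subset.antisymm
        · intro z hz
          have := hxq.2.2 z (hP hz).1 (by rw [e]; exact (hP hz).2)
          rw [e] at this
          exact this
        · intro z hz; rcases hz with rfl | rfl; exacts [hx, hy]
      rw [e' _ g2.1 hm.1 hm.2, e' _ g3.1 hm2.1 hm2.2]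
  have hbx : b ≠ x := by
    rintro rfl
    have := mul_right_cancel el
    rw [this] at hqP
    exact hqP hc
  obtain ⟨a, ha, hab⟩ := down g2 hm.1 b hb hbx
  refine ⟨a, b, c, ha, hb, hc, hab, hbc, ?_⟩
  obtain ⟨e, f, he, hf, hef, el2⟩ := poly_label cs h ha hb hab
  refine ⟨x, q, e, f, hm2.1, hq, he, hf, hxq, hef, el.symm, el2, ?_⟩
  apply cov_min cs g3.2.1 hq he hxq (g3.1 he).1
  rintro rfl
  have hfq : f = q := by
    have k1 := cov_min cs g3.2.1 hq hf hxq hef.1 hef.2.1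
    have k2 := cov_min cs g3.2.1 hf hq hef hxq.1 hxq.2.1
    exact wle_antisymm cs k2 k1
  rw [hfq, el] at el2
  exact (NN_cov cs hbc).1 (by rw [← el2]; exact ((NN_cov cs hab).2 _).2 (Or.inr rfl))

/-- Non-commuting inversions of a chain. -/
def invPairs (cs : CoxeterSystem M W) (ω : List B) (C : Set W) : Set (W × W) :=
  {p | p.1 * p.2 ≠ p.2 * p.1 ∧ seqBefore cs ω p.1 p.2 ∧ chainBefore cs C p.2 p.1}

lemma seqBefore_trans (cs : CoxeterSystem M W) {ω : List B} (hω : cs.IsReduced ω) {a b c : W}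
    (h1 : seqBefore cs ω a b) (h2 : seqBefore cs ω b c) : seqBefore cs ω a c := by
  obtain ⟨j, k, hjk, hj, hk⟩ := h1
  obtain ⟨k', l, hkl, hk', hl⟩ := h2
  have : k = k' := by
    have hlt : k < (cs.leftInvSeq ω).length := (List.getElem?_eq_some_iff.1 hk).1
    exact (List.getElem?_inj hlt hω.nodup_leftInvSeq).1 (hk.trans hk'.symm)
  exact ⟨j, l, by omega, hj, hl⟩

lemma seqBefore_irrefl (cs : CoxeterSystem M W) {ω : List B} (hω : cs.IsReduced ω) {a : W}
    (h1 : seqBefore cs ω a a) : False := by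
  obtain ⟨k, k', hjk, hk, hk'⟩ := h1
  have : k = k' := by
    have hlt : k < (cs.leftInvSeq ω).length := (List.getElem?_eq_some_iff.1 hk).1
    exact (List.getElem?_inj hlt hω.nodup_leftInvSeq).1 (hk.trans hk'.symm)
  omega

lemma seqBefore_of_heap (cs : CoxeterSystem M W) {ω : List B} (hω : cs.IsReduced ω) {a b : W}
    (h : heapLt cs ω a b) : seqBefore cs ω a b := by
  induction h with
  | single h =>
    obtain ⟨j, k, h1, h2, h3, _⟩ := h
    exact ⟨j, k, h1, h2, h3⟩
  | tail _ h ih =>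
    obtain ⟨j, k, h1, h2, h3, _⟩ := h
    exact seqBefore_trans cs hω ih ⟨j, k, h1, h2, h3⟩

lemma sq_step (cs : CoxeterSystem M W) [Finite W] (ω : List B) {C C' : Set W}
    (hC : IsChain (weakLE cs) C) (h : SquareMove (weakLE cs) C C') :
    IsChain (weakLE cs) C' ∧ invPairs cs ω C ⊆ invPairs cs ω C' := by
  obtain ⟨x, y, P₁, P₂, hp, h4, h1, h2, hd⟩ := h
  refine ⟨poly_chain cs hp hC h1 hd, ?_⟩
  rintro ⟨t, t'⟩ ⟨a, b, c⟩
  refine ⟨a, b, ?_⟩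
  rcases poly_before cs hp hC h1 h2 hd c with e | e
  · exact e
  · exact absurd (square_comm cs hp h4 e).symm a

lemma inc_step (cs : CoxeterSystem M W) [Finite W] {ω : List B} (hω : cs.IsReduced ω) {C C' : Set W}
    (hC : IsChain (weakLE cs) C)
    (h : IncPolygonMove (weakLE cs) (fun u w => w * u⁻¹) (heapLt cs ω) C C') :
    IsChain (weakLE cs) C' ∧ invPairs cs ω C ⊆ invPairs cs ω C' ∧
      ¬ invPairs cs ω C' ⊆ invPairs cs ω C := by
  obtain ⟨x, y, P₁, P₂, hp, h4, h1, h2, hd, hasc⟩ := h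
  refine ⟨poly_chain cs hp hC h1 hd, ?_, ?_⟩
  · rintro ⟨t, t'⟩ ⟨a, b, c⟩
    refine ⟨a, b, ?_⟩
    rcases poly_before cs hp hC h1 h2 hd c with e | e
    · exact e
    · obtain ⟨p, q, r, s, e1, e2, e3, e4, e5, e6, e7, e8, e9⟩ := e
      have := seqBefore_of_heap cs hω (hasc p q r s e1 e2 e3 e4 e5 e6 e9)
      simp only [← e7, ← e8] at this
      exact absurd (seqBefore_trans cs hω b this) (seqBefore_irrefl cs hω)
  · intro hsub
    obtain ⟨a, b, c, ha, hb, hc, hab, hbc, hbef⟩ := nonsquare_swap cs hp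
    have hnc := nonsquare_noncomm cs hp h4 ha hb hc hab hbc
    have hs := seqBefore_of_heap cs hω (hasc a b b c ha hb hb hc hab hbc (wle_refl cs b))
    have hmem : (b * a⁻¹, c * b⁻¹) ∈ invPairs cs ω C' := by
      refine ⟨hnc, hs, ?_⟩
      obtain ⟨p, q, r, s, e1, e2, e3, e4, e5⟩ := hbef
      exact ⟨p, q, r, s, h2 e1, h2 e2, h2 e3, h2 e4, e5⟩
    exact before_asymm cs hC (hsub hmem).2.2
      ⟨a, b, b, c, h1 ha, h1 hb, h1 hb, h1 hc, hab, hbc, rfl, rfl, wle_refl cs b⟩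

lemma sq_steps (cs : CoxeterSystem M W) [Finite W] (ω : List B) {C C' : Set W}
    (hC : IsChain (weakLE cs) C) (h : SqEquiv (weakLE cs) C C') :
    IsChain (weakLE cs) C' ∧ invPairs cs ω C ⊆ invPairs cs ω C' := by
  induction h with
  | refl => exact ⟨hC, subset_rfl⟩
  | tail _ h ih =>
    obtain ⟨a, b⟩ := sq_step cs ω ih.1 h
    exact ⟨a, ih.2.trans b⟩

lemma mg_steps (cs : CoxeterSystem M W) [Finite W] {ω : List B} (hω : cs.IsReduced ω) {C C' : Set W}
    (hC : IsChain (weakLE cs) C)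
    (h : MGPre (weakLE cs) (fun u w => w * u⁻¹) (heapLt cs ω) C C') :
    IsChain (weakLE cs) C' ∧ invPairs cs ω C ⊆ invPairs cs ω C' ∧
      (invPairs cs ω C' ⊆ invPairs cs ω C → SqEquiv (weakLE cs) C C') := by
  induction h with
  | refl => exact ⟨hC, subset_rfl, fun _ => Relation.ReflTransGen.refl⟩
  | tail _ h ih =>
    obtain ⟨i1, i2, i3⟩ := ih
    rcases h with h | h
    · obtain ⟨a, b⟩ := sq_steps cs ω i1 h
      exact ⟨a, i2.trans b, fun hh => (i3 (b.trans hh)).trans h⟩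
    · obtain ⟨a, b, c⟩ := inc_step cs hω i1 h
      exact ⟨a, i2.trans b, fun hh => absurd (hh.trans i2) c⟩

end Aux

/-- Let `(W, S)` be a finite Coxeter system, `w₀` its longest element, and `ω₀` a
reduced word for `w₀`.  The preorder on square-equivalence classes of maximal
chains of the right weak order generated by increasing polygon moves with
respect to the heap poset of `ω₀` is a partial order: it is antisymmetric on
square-equivalence classes. -/
theorem weak_order_mgpre_partial_order {B W : Type*} [Group W]
    {M : CoxeterMatrix B} (cs : CoxeterSystem M W) [Finite W]
    (w₀ : W) (hw₀ : ∀ w : W, cs.length w ≤ cs.length w₀)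
    (ω₀ : List B) (hω₀ : cs.IsReduced ω₀) (hω₀p : cs.wordProd ω₀ = w₀) :
    ∀ C C' : Set W, IsMaxChain (weakLE cs) C → IsMaxChain (weakLE cs) C' →
      MGPre (weakLE cs) (fun u w => w * u⁻¹) (heapLt cs ω₀) C C' →
      MGPre (weakLE cs) (fun u w => w * u⁻¹) (heapLt cs ω₀) C' C →
      SqEquiv (weakLE cs) C C' := by
  intro C C' hC _ h1 h2
  obtain ⟨a, _, c⟩ := mg_steps cs hω₀ hC.1 h1
  exact c (mg_steps cs hω₀ a h2).2.1
end
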